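/- arXiv:2603.29190 — 3 statements merged into one kernel-verified Lean document; each statement's English description precedes it below -/
import Mathlib

section
/- Let E and F be finite-dimensional real normed vector spaces, X = E × F with the sup norm, and let 0 < λ < λ̃ < (1+λ)/2, η > 0, and n a positive integer. For each j = 0,…,n−1 let F_j : X → X be C¹ on the closed ball B̄(0,η) with blocks A_j, B_j, C_j, D_j of DF_j(0) satisfying ‖A_j v‖ ≥ λ^{-1}‖v‖ for all v ∈ E, ‖D_j‖ ≤ λ, ‖B_j‖ ≤ (1+λ−2λ̃)/4, ‖C_j‖ ≤ (1+λ−2λ̃)/4, and ‖DF_j(ξ) − DF_j(0)‖ ≤ (λ̃−λ)/4 for all ‖ξ‖ ≤ η; and let G_j : X → X be continuous maps and d, δ ≥ 0 numbers with ‖F_j(0)‖ ≤ δ, ‖G_j(ξ) − F_j(ξ)‖ ≤ d for all ‖ξ‖ ≤ η, and d + δ ≤ (1−λ̃)η/2. Then there exist points v_0, v_1, …, v_n ∈ X with ‖v_j‖ ≤ η for all j = 0,…,n and v_{j+1} = G_j(v_j) for all j = 0,…,n−1. -/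
open Polynomial in
/-- For distinct nodes, one more than the dimension, the determinant of `1 + L` is a fixed affine
combination of the determinants of `1 + t • L` at the nodes `t`. -/
lemma LinearMap.exists_affine_combination_det_one_add_smul (V : Type*) [AddCommGroup V] [Module ℝ V]
    [FiniteDimensional ℝ V] (s : Finset ℝ) (hs : Module.finrank ℝ V < s.card) :
    ∃ c : ℝ → ℝ, ∑ t ∈ s, c t = 1 ∧
      ∀ L : V →ₗ[ℝ] V, LinearMap.det (1 + L) = ∑ t ∈ s, c t * LinearMap.det (1 + t • L) := by
  classical
  have hne : s.Nonempty := Finset.card_pos.mp (by omega)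
  have hinj : Set.InjOn (_root_.id : ℝ → ℝ) (s : Set ℝ) := Function.injective_id.injOn
  refine ⟨fun t => (Lagrange.basis s _root_.id t).eval 1, ?_, fun L => ?_⟩
  · rw [← eval_finsetSum, Lagrange.sum_basis hinj hne, eval_one]
  · let b := Module.finBasis ℝ V
    let A := LinearMap.toMatrix b b L
    let p : ℝ[X] := Matrix.det ((X : ℝ[X]) • A.map C + (1 : Matrix _ _ ℝ).map C)
    have hp (t : ℝ) : p.eval t = LinearMap.det (1 + t • L) := by
      rw [← coe_evalRingHom, RingHom.map_det, ← LinearMap.det_toMatrix b]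
      congr 1
      ext i j
      by_cases hij : i = j <;> simp [A, hij, add_comm, mul_comm t]
    have hdeg : p.degree < s.card := by
      refine lt_of_le_of_lt degree_le_natDegree ?_
      have := natDegree_det_X_add_C_le A 1
      simp only [Fintype.card_fin] at this
      exact_mod_cast this.trans_lt hs
    have h1 := hp 1
    rw [Lagrange.eq_interpolate hinj hdeg, Lagrange.interpolate_apply, eval_finsetSum, one_smul] at h1
    rw [← h1]
    refine Finset.sum_congr rfl fun t _ => ?_
    rw [eval_mul, eval_C, _root_.id, hp, mul_comm]

/-- A perturbation of the identity by an operator of norm less than one has positive determinant. -/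
lemma ContinuousLinearMap.det_one_add_pos {V : Type*} [NormedAddCommGroup V] [NormedSpace ℝ V]
    [FiniteDimensional ℝ V] {L : V →L[ℝ] V} (hL : ‖L‖ < 1) : 0 < (1 + L).det := by
  have : CompleteSpace V := FiniteDimensional.complete ℝ V
  have hne (s : ℝ) (hs : s ∈ Set.Icc (0 : ℝ) 1) : (1 + s • L).det ≠ 0 := by
    have hlt : ‖-(s • L)‖ < 1 := by
      rw [norm_neg, norm_smul, Real.norm_of_nonneg hs.1]
      nlinarith [norm_nonneg L, hs.1, hs.2]
    have hu := isUnit_one_sub_of_norm_lt_one hlt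
    rw [sub_neg_eq_add] at hu
    have h2 := hu.map (ContinuousLinearMap.toLinearMapRingHom (R₁ := ℝ) (M₁ := V))
    exact ((LinearMap.isUnit_iff_isUnit_det _).mp h2).ne_zero
  by_contra! hneg
  have hc : ContinuousOn (fun s : ℝ => (1 + s • L).det) (Set.Icc 0 1) :=
    (ContinuousLinearMap.continuous_det.comp (by fun_prop)).continuousOn
  have h0 : (1 + (0 : ℝ) • L).det = 1 := by
    rw [zero_smul, add_zero]; exact LinearMap.det_id
  obtain ⟨s, hs, hs0⟩ := intermediate_value_Icc' zero_le_one hc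
    (show (0 : ℝ) ∈ _ from ⟨by simpa using hneg, by simp only [h0]; exact zero_le_one⟩)
  exact hne s hs hs0

open Metric Set MeasureTheory in
/-- There is no continuously differentiable retraction of the closed unit ball onto the sphere. -/
lemma not_exists_contDiffAt_retraction_sphere {V : Type*} [NormedAddCommGroup V]
    [InnerProductSpace ℝ V] [FiniteDimensional ℝ V] (r : V → V)
    (hr : ∀ x ∈ closedBall (0 : V) 1, ContDiffAt ℝ 1 r x)
    (hnorm : ∀ x ∈ closedBall (0 : V) 1, ‖r x‖ = 1)
    (hfix : ∀ x ∈ sphere (0 : V) 1, r x = x) : False := by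
  have hcomp : CompleteSpace V := FiniteDimensional.complete ℝ V
  borelize V
  let μ : Measure V := Measure.addHaar
  let M : V → V →L[ℝ] V := fun x => fderiv ℝ r x - 1
  have hK : IsCompact (closedBall (0 : V) 1) := isCompact_closedBall 0 1
  have hM : ContinuousOn M (closedBall 0 1) := fun x hx =>
    (((hr x hx).fderiv_right (m := 0) (by norm_num)).continuousAt.sub
      continuousAt_const).continuousWithinAt
  have hderiv (x : V) (hx : x ∈ closedBall (0 : V) 1) (t : ℝ) :
      HasStrictFDerivAt (fun y => y + t • (r y - y)) (1 + t • M x) x :=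
    (hasStrictFDerivAt_id x).add
      ((((hr x hx).hasStrictFDerivAt one_ne_zero).sub (hasStrictFDerivAt_id x)).const_smul t)
  obtain ⟨C, hC⟩ := hK.exists_bound_of_continuousOn hM
  have hC0 : 0 ≤ C := (norm_nonneg _).trans (hC 0 (by simp))
  have hinfinite : (Ioo (0 : ℝ) (1 / (C + 1))).Infinite := Ioo_infinite (by positivity)
  obtain ⟨s, hs, hcard⟩ := hinfinite.exists_subset_card_eq (Module.finrank ℝ V + 1)
  obtain ⟨c, hc, hdet⟩ := LinearMap.exists_affine_combination_det_one_add_smul V s (by omega)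
  have hvol (t : ℝ) (ht : t ∈ s) :
      ∫ x in ball (0 : V) 1, (1 + t • M x).det ∂μ = μ.real (ball (0 : V) 1) := by
    obtain ⟨ht0, ht1⟩ := hs ht
    have htC : t * (C + 1) < 1 := by rwa [lt_div_iff₀ (by positivity)] at ht1
    have htlt : t < 1 := by nlinarith
    have hsmall (x : V) (hx : x ∈ closedBall (0 : V) 1) : ‖t • M x‖ < 1 := by
      rw [norm_smul, Real.norm_of_nonneg ht0.le]
      nlinarith [hC x hx]
    let f : V → V := fun y => y + t • (r y - y)
    have hinj : InjOn f (closedBall 0 1) := by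
      intro x hx y hy hxy
      have hle := (convex_closedBall (0 : V) 1).norm_image_sub_le_of_norm_hasFDerivWithin_le'
        (f := f) (φ := 1) (C := t * C)
        (fun z hz => (hderiv z hz t).hasFDerivAt.hasFDerivWithinAt)
        (fun z hz => by
          rw [add_sub_cancel_left, norm_smul, Real.norm_of_nonneg ht0.le]
          gcongr
          exact hC z hz) hx hy
      rw [hxy, sub_self, zero_sub, norm_neg, one_apply_eq_self] at hle
      have : ‖y - x‖ = 0 := by nlinarith [norm_nonneg (y - x)]
      exact (sub_eq_zero.mp (norm_eq_zero.mp this)).symm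
    have hmaps : MapsTo f (ball 0 1) (ball 0 1) := by
      intro x hx
      have hrx := hnorm x (ball_subset_closedBall hx)
      rw [mem_ball_zero_iff] at hx ⊢
      calc ‖f x‖ = ‖(1 - t) • x + t • r x‖ := by
            congr 1
            simp only [f]
            module
        _ ≤ (1 - t) * ‖x‖ + t * 1 := by
            refine (norm_add_le _ _).trans_eq ?_
            rw [norm_smul, norm_smul, hrx, Real.norm_of_nonneg ht0.le,
              Real.norm_of_nonneg (by linarith)]
        _ < 1 := by nlinarith
    have hfsphere (x : V) (hx : x ∈ sphere (0 : V) 1) : f x = x := by simp [f, hfix x hx]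
    have hopen : IsOpen (f '' ball 0 1) := by
      rw [isOpen_iff_mem_nhds]
      rintro _ ⟨x, hx, rfl⟩
      have hx' := ball_subset_closedBall hx
      have hd := ContinuousLinearMap.det_one_add_pos (hsmall x hx')
      have hrange : (1 + t • M x).range = ⊤ :=
        (LinearMap.isUnit_iff_range_eq_top _).mp
          ((LinearMap.isUnit_iff_isUnit_det _).mpr (isUnit_iff_ne_zero.mpr hd.ne'))
      rw [← (hderiv x hx' t).map_nhds_eq_of_surj hrange]
      exact Filter.image_mem_map (isOpen_ball.mem_nhds hx)
    have hclosed : IsClosed (f '' closedBall 0 1) :=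
      (hK.image_of_continuousOn fun x hx =>
        (hderiv x hx t).hasFDerivAt.continuousAt.continuousWithinAt).isClosed
    have himage : f '' ball 0 1 = ball 0 1 := by
      refine hmaps.image_subset.antisymm ?_
      refine (convex_ball (0 : V) 1).isPreconnected.subset_left_of_subset_union hopen
        hclosed.isOpen_compl ?_ ?_ ?_
      · exact disjoint_compl_right_iff_subset.mpr (image_mono ball_subset_closedBall)
      · intro y hy
        by_cases hy' : y ∈ f '' closedBall 0 1
        · obtain ⟨x, hx, rfl⟩ := hy'
          rw [← ball_union_sphere] at hx
          rcases hx with hx | hx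
          · exact Or.inl ⟨x, hx, rfl⟩
          · rw [hfsphere x hx] at hy
            exact absurd (mem_sphere.mp hx) (mem_ball.mp hy).ne
        · exact Or.inr hy'
      · have h0 : (0 : V) ∈ ball (0 : V) 1 := by simp
        exact ⟨f 0, hmaps h0, 0, h0, rfl⟩
    have key := integral_image_eq_integral_abs_det_fderiv_smul μ measurableSet_ball
      (fun x hx => (hderiv x (ball_subset_closedBall hx) t).hasFDerivAt.hasFDerivWithinAt)
      (hinj.mono ball_subset_closedBall) (fun _ => (1 : ℝ))
    change ∫ x in f '' ball 0 1, (1 : ℝ) ∂μ = _ at key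
    rw [himage, setIntegral_const, smul_eq_mul, mul_one] at key
    rw [key]
    refine setIntegral_congr_fun measurableSet_ball fun x hx => ?_
    have hd := ContinuousLinearMap.det_one_add_pos (hsmall x (ball_subset_closedBall hx))
    simp only [smul_eq_mul, mul_one]
    exact (abs_of_pos hd).symm
  have hzero (x : V) (hx : x ∈ ball (0 : V) 1) : (1 + M x).det = 0 := by
    have hM' : 1 + M x = fderiv ℝ r x := by simp [M]
    have hx' := ball_subset_closedBall hx
    have hinner (v : V) : inner ℝ (r x) (fderiv ℝ r x v) = 0 := by
      have hd := ((hr x hx').differentiableAt one_ne_zero).hasFDerivAt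
      have h1 := hd.norm_sq
      have h2 : (fun y => ‖r y‖ ^ 2) =ᶠ[nhds x] fun _ => 1 := by
        filter_upwards [isOpen_ball.mem_nhds hx] with y hy
        rw [hnorm y (ball_subset_closedBall hy), one_pow]
      have h3 := h1.unique ((hasFDerivAt_const (1 : ℝ) x).congr_of_eventuallyEq h2)
      simpa using congrArg (fun L => L v) h3
    by_contra hne
    rw [hM'] at hne
    have hsurj : Function.Surjective (fderiv ℝ r x) :=
      LinearMap.range_eq_top.mp ((LinearMap.isUnit_iff_range_eq_top _).mp
        ((LinearMap.isUnit_iff_isUnit_det _).mpr (isUnit_iff_ne_zero.mpr hne)))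
    obtain ⟨v, hv⟩ := hsurj (r x)
    have := hinner v
    rw [hv, real_inner_self_eq_norm_sq, hnorm x hx'] at this
    norm_num at this
  have hint (t : ℝ) : IntegrableOn (fun x => (1 + t • M x).det) (ball (0 : V) 1) μ := by
    refine (ContinuousOn.integrableOn_compact hK ?_).mono_set ball_subset_closedBall
    exact ContinuousLinearMap.continuous_det.comp_continuousOn
      (continuousOn_const.add (hM.const_smul t))
  have hpos : 0 < μ.real (ball (0 : V) 1) :=
    ENNReal.toReal_pos (measure_ball_pos μ 0 one_pos).ne' measure_ball_lt_top.ne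
  have hsum : ∫ x in ball (0 : V) 1, (1 + M x).det ∂μ = μ.real (ball (0 : V) 1) := by
    calc ∫ x in ball (0 : V) 1, (1 + M x).det ∂μ
        = ∫ x in ball (0 : V) 1, ∑ t ∈ s, c t * (1 + t • M x).det ∂μ := by
          congr with x
          exact hdet (M x : V →ₗ[ℝ] V)
      _ = ∑ t ∈ s, c t * ∫ x in ball (0 : V) 1, (1 + t • M x).det ∂μ := by
          rw [integral_finsetSum _ fun t _ => (hint t).const_mul _]
          simp only [integral_const_mul]
      _ = μ.real (ball (0 : V) 1) := by
          rw [Finset.sum_congr rfl fun t ht => by rw [hvol t ht], ← Finset.sum_mul, hc, one_mul]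
  rw [setIntegral_congr_fun measurableSet_ball hzero] at hsum
  simp at hsum
  linarith

open Metric in
/-- A continuous self-map of a Euclidean space with values in the closed unit ball has a fixed
point. -/
lemma exists_fixedPoint_of_norm_le_one {V : Type*} [NormedAddCommGroup V]
    [InnerProductSpace ℝ V] [FiniteDimensional ℝ V] {f : V → V} (hf : Continuous f)
    (hbound : ∀ x, ‖f x‖ ≤ 1) : ∃ x, f x = x := by
  by_contra! hne
  have : CompleteSpace V := FiniteDimensional.complete ℝ V
  obtain ⟨g, hg⟩ := exists_contMDiffMap_forall_mem_convex_of_local_const (n := 1)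
    (modelWithCornersSelf ℝ V)
    (t := fun y => ball (f y) ‖f y - y‖ ∩ closedBall 0 1)
    (fun y => (convex_ball _ _).inter (convex_closedBall _ _)) fun x => by
      refine ⟨f x, ?_⟩
      have hlt : dist (f x) (f x) < ‖f x - x‖ := by
        rw [dist_self]
        exact norm_pos_iff.mpr (sub_ne_zero.mpr (hne x))
      have hev : ∀ᶠ y in nhds x, dist (f x) (f y) < ‖f y - y‖ :=
        (continuous_const.dist hf).continuousAt.eventually_lt
          ((hf.sub continuous_id).norm).continuousAt hlt
      filter_upwards [hev] with y hy
      exact ⟨hy, by simpa using hbound x⟩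
  have hgd : ContDiff ℝ 1 g := g.contMDiff.contDiff
  have hg1 (x : V) : ‖g x‖ ≤ 1 := by simpa using (hg x).2
  have hu (x : V) : x - g x ≠ 0 := by
    intro h
    have h1 := (hg x).1
    rw [← sub_eq_zero.mp h, mem_ball, dist_comm, dist_eq_norm] at h1
    exact lt_irrefl _ h1
  let b : V → ℝ := fun x => inner ℝ x (x - g x)
  let q : V → ℝ := fun x => b x ^ 2 + ‖x - g x‖ ^ 2 * (1 - ‖x‖ ^ 2)
  let τ : V → ℝ := fun x => (-b x + √(q x)) / ‖x - g x‖ ^ 2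
  have hbpos (x : V) (hx : ‖x‖ = 1) : 0 < b x := by
    have h1 := norm_sub_sq_real x (x - g x)
    rw [sub_sub_cancel, hx] at h1
    have h2 := norm_pos_iff.mpr (hu x)
    simp only [b]
    nlinarith [hg1 x, norm_nonneg (g x)]
  have hqpos (x : V) (hx : x ∈ closedBall (0 : V) 1) : 0 < q x := by
    rw [mem_closedBall_zero_iff] at hx
    have h2 := norm_pos_iff.mpr (hu x)
    rcases hx.lt_or_eq with hlt | heq
    · have : 0 < 1 - ‖x‖ ^ 2 := by nlinarith [norm_nonneg x]
      simp only [q]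
      positivity
    · have := hbpos x heq
      simp only [q, heq]
      norm_num
      positivity
  have hud : ContDiff ℝ 1 fun x => x - g x := contDiff_id.sub hgd
  have hbd : ContDiff ℝ 1 b := contDiff_id.inner ℝ hud
  have hqd : ContDiff ℝ 1 q :=
    (hbd.pow 2).add ((hud.norm_sq ℝ).mul (contDiff_const.sub (contDiff_id.norm_sq ℝ)))
  refine not_exists_contDiffAt_retraction_sphere (fun x => x + τ x • (x - g x))
    (fun x hx => ?_) (fun x hx => ?_) (fun x hx => ?_)
  · have hτ : ContDiffAt ℝ 1 τ x :=
      (hbd.neg.contDiffAt.add (hqd.contDiffAt.sqrt (hqpos x hx).ne')).div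
        (hud.norm_sq ℝ).contDiffAt (by simpa using hu x)
    exact contDiffAt_id.add (hτ.smul hud.contDiffAt)
  · have h2 := norm_pos_iff.mpr (hu x)
    have hτ : τ x * ‖x - g x‖ ^ 2 = -b x + √(q x) := div_mul_cancel₀ _ (by positivity)
    have hsq := Real.sq_sqrt (hqpos x hx).le
    have hexp : ‖x + τ x • (x - g x)‖ ^ 2
        = ‖x‖ ^ 2 + 2 * τ x * b x + τ x ^ 2 * ‖x - g x‖ ^ 2 := by
      rw [norm_add_sq_real, inner_smul_right, norm_smul, mul_pow, Real.norm_eq_abs, sq_abs]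
      ring
    have hone : ‖x + τ x • (x - g x)‖ ^ 2 = 1 := by
      have : ‖x - g x‖ ^ 2 * (‖x + τ x • (x - g x)‖ ^ 2 - 1) = 0 := by
        rw [hexp]
        have hs : √(q x) = τ x * ‖x - g x‖ ^ 2 + b x := by linarith
        rw [hs] at hsq
        simp only [q] at hsq
        linear_combination hsq
      have h3 := (mul_eq_zero.mp this).resolve_left (by positivity)
      linarith
    exact (pow_eq_one_iff_of_nonneg (norm_nonneg _) two_ne_zero).mp hone
  · have hx' : ‖x‖ = 1 := by simpa using hx
    have hq : q x = b x ^ 2 := by simp [q, hx']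
    simp [τ, hq, Real.sqrt_sq (hbpos x hx').le]

open Metric in
/-- **Brouwer's fixed point theorem** for a closed ball of a finite-dimensional normed space. -/
theorem exists_fixedPoint_of_mapsTo_closedBall {W : Type*} [NormedAddCommGroup W]
    [NormedSpace ℝ W] [FiniteDimensional ℝ W] {f : W → W} (hf : Continuous f) {R : ℝ} (hR : 0 < R)
    (hmaps : Set.MapsTo f (closedBall 0 R) (closedBall 0 R)) :
    ∃ x ∈ closedBall (0 : W) R, f x = x := by
  let e : W ≃L[ℝ] EuclideanSpace ℝ (Fin (Module.finrank ℝ W)) := toEuclidean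
  let ρ : W → W := fun x => (R / max R ‖x‖) • x
  have hmax (x : W) : 0 < max R ‖x‖ := lt_max_of_lt_left hR
  have hρc : Continuous ρ :=
    (continuous_const.div (continuous_const.max continuous_norm) fun x => (hmax x).ne').smul
      continuous_id
  have hρ (x : W) : ρ x ∈ closedBall (0 : W) R := by
    rw [mem_closedBall_zero_iff, norm_smul, Real.norm_of_nonneg (by have := hmax x; positivity),
      div_mul_eq_mul_div, div_le_iff₀ (hmax x)]
    gcongr
    exact le_max_right _ _
  have hρid (x : W) (hx : x ∈ closedBall (0 : W) R) : ρ x = x := by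
    rw [mem_closedBall_zero_iff] at hx
    simp only [ρ]
    rw [max_eq_left hx, div_self hR.ne', one_smul]
  obtain ⟨S, hS⟩ := (isCompact_closedBall (0 : W) R).exists_bound_of_continuousOn
    e.continuous.continuousOn
  have hS0 : 0 ≤ S := (norm_nonneg _).trans (hS 0 (by simpa using hR.le))
  have hS1 : 0 < S + 1 := by positivity
  obtain ⟨y, hy⟩ := exists_fixedPoint_of_norm_le_one
    (f := fun y => (S + 1)⁻¹ • e (f (ρ (e.symm ((S + 1) • y)))))
    (by fun_prop) fun y => by
      rw [norm_smul, norm_inv, Real.norm_of_nonneg hS1.le, inv_mul_le_one₀ hS1]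
      linarith [hS _ (hmaps (hρ (e.symm ((S + 1) • y))))]
  have hx : f (ρ (e.symm ((S + 1) • y))) = e.symm ((S + 1) • y) := by
    rw [inv_smul_eq_iff₀ hS1.ne'] at hy
    exact (e.symm_apply_eq.mpr hy.symm).symm
  have hmem : e.symm ((S + 1) • y) ∈ closedBall (0 : W) R := hx ▸ hmaps (hρ _)
  exact ⟨_, hmem, by rwa [hρid _ hmem] at hx⟩

/-- An expanding endomorphism of a finite-dimensional space has a contracting right inverse. -/
lemma LinearMap.exists_rightInverse_of_le_norm {E : Type*} [NormedAddCommGroup E]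
    [NormedSpace ℝ E] [FiniteDimensional ℝ E] (A : E →ₗ[ℝ] E) {c : ℝ} (hc : 0 < c)
    (hA : ∀ v, c⁻¹ * ‖v‖ ≤ ‖A v‖) :
    ∃ P : E →L[ℝ] E, (∀ x, A (P x) = x) ∧ ∀ x, ‖P x‖ ≤ c * ‖x‖ := by
  have hinj : Function.Injective A := by
    rw [← LinearMap.ker_eq_bot, LinearMap.ker_eq_bot']
    intro v hv
    have h := hA v
    rw [hv, norm_zero] at h
    have : 0 < c⁻¹ := inv_pos.mpr hc
    exact norm_eq_zero.mp (by nlinarith [norm_nonneg v])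
  let e := LinearEquiv.ofInjectiveEndo A hinj
  have he (x : E) : A (e.symm x) = x := e.apply_symm_apply x
  refine ⟨LinearMap.toContinuousLinearMap e.symm.toLinearMap, he, fun x => ?_⟩
  have h := hA (e.symm x)
  rw [he, inv_mul_le_iff₀ hc] at h
  exact h

/-- Theorem 3.1 (local chart form of finite bi-shadowing): under uniform
semi-hyperbolicity bounds on the local maps F_j (j = 0,…,n−1) and smallness of
the perturbations G_j and of the jumps F_j(0), there is a finite orbit of the
maps G_j staying in the closed η-ball. -/
theorem finite_bi_shadowing_local
    {E F : Type*} [NormedAddCommGroup E] [NormedSpace ℝ E]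
    [NormedAddCommGroup F] [NormedSpace ℝ F]
    [FiniteDimensional ℝ E] [FiniteDimensional ℝ F]
    (lam lamt η d δ : ℝ) (h0 : 0 < lam) (h1 : lam < lamt)
    (h2 : lamt < (1 + lam) / 2) (hη : 0 < η) (hd : 0 ≤ d) (hδ : 0 ≤ δ)
    (n : ℕ) (hn : 0 < n)
    (Fmap : ℕ → E × F → E × F) (DF : ℕ → E × F → (E × F) →L[ℝ] E × F)
    (G : ℕ → E × F → E × F)
    (hderiv : ∀ j < n, ∀ ξ ∈ Metric.closedBall (0 : E × F) η,
      HasFDerivAt (Fmap j) (DF j ξ) ξ)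
    (hcont : ∀ j < n, ContinuousOn (DF j) (Metric.closedBall (0 : E × F) η))
    (hA : ∀ j < n, ∀ v : E, lam⁻¹ * ‖v‖ ≤ ‖(DF j 0 (v, 0)).1‖)
    (hD : ∀ j < n, ‖(ContinuousLinearMap.snd ℝ E F).comp
        ((DF j 0).comp (ContinuousLinearMap.inr ℝ E F))‖ ≤ lam)
    (hB : ∀ j < n, ‖(ContinuousLinearMap.fst ℝ E F).comp
        ((DF j 0).comp (ContinuousLinearMap.inr ℝ E F))‖ ≤ (1 + lam - 2 * lamt) / 4)
    (hC : ∀ j < n, ‖(ContinuousLinearMap.snd ℝ E F).comp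
        ((DF j 0).comp (ContinuousLinearMap.inl ℝ E F))‖ ≤ (1 + lam - 2 * lamt) / 4)
    (hclose : ∀ j < n, ∀ ξ : E × F, ‖ξ‖ ≤ η → ‖DF j ξ - DF j 0‖ ≤ (lamt - lam) / 4)
    (hGcont : ∀ j < n, Continuous (G j))
    (hF0 : ∀ j < n, ‖Fmap j 0‖ ≤ δ)
    (hGF : ∀ j < n, ∀ ξ : E × F, ‖ξ‖ ≤ η → ‖G j ξ - Fmap j ξ‖ ≤ d)
    (hsum : d + δ ≤ (1 - lamt) * η / 2) :
    ∃ v : ℕ → E × F, (∀ j ≤ n, ‖v j‖ ≤ η) ∧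
      ∀ j < n, v (j + 1) = G j (v j) := by
  have hlt : lamt < 1 := by linarith
  have hremainder (j : ℕ) (hj : j < n) (ξ : E × F) (hξ : ‖ξ‖ ≤ η) :
      ‖G j ξ - DF j 0 ξ‖ ≤ d + δ + (lamt - lam) / 4 * η := by
    have hmean := (convex_closedBall (0 : E × F) η).norm_image_sub_le_of_norm_hasFDerivWithin_le'
      (f := Fmap j) (φ := DF j 0) (fun z hz => (hderiv j hj z hz).hasFDerivWithinAt)
      (fun z hz => hclose j hj z (mem_closedBall_zero_iff.mp hz))
      (Metric.mem_closedBall_self hη.le) (mem_closedBall_zero_iff.mpr hξ)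
    rw [sub_zero] at hmean
    have hmean' : ‖Fmap j ξ - Fmap j 0 - DF j 0 ξ‖ ≤ (lamt - lam) / 4 * η :=
      hmean.trans (by gcongr)
    calc ‖G j ξ - DF j 0 ξ‖
        = ‖(G j ξ - Fmap j ξ) + Fmap j 0 + (Fmap j ξ - Fmap j 0 - DF j 0 ξ)‖ := by
          congr 1
          abel
      _ ≤ d + δ + (lamt - lam) / 4 * η :=
          (norm_add₃_le).trans (add_le_add_three (hGF j hj ξ hξ) (hF0 j hj) hmean')
  have hsplit (j : ℕ) (ξ : E × F) : DF j 0 ξ = DF j 0 (ξ.1, 0) + DF j 0 (0, ξ.2) := by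
    rw [← map_add]
    simp
  have hstable (j : ℕ) (hj : j < n) (ξ : E × F) (hξ : ‖ξ‖ ≤ η) : ‖(G j ξ).2‖ ≤ η := by
    have hR := (norm_snd_le _).trans (hremainder j hj ξ hξ)
    have hξ1 : ‖ξ.1‖ ≤ η := (norm_fst_le ξ).trans hξ
    have hξ2 : ‖ξ.2‖ ≤ η := (norm_snd_le ξ).trans hξ
    have hCξ : ‖(DF j 0 (ξ.1, 0)).2‖ ≤ (1 + lam - 2 * lamt) / 4 * η :=
      (ContinuousLinearMap.le_of_opNorm_le_of_le _ (hC j hj) hξ1)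
    have hDξ : ‖(DF j 0 (0, ξ.2)).2‖ ≤ lam * η :=
      (ContinuousLinearMap.le_of_opNorm_le_of_le _ (hD j hj) hξ2)
    have heq : (G j ξ).2
        = (DF j 0 (ξ.1, 0)).2 + (DF j 0 (0, ξ.2)).2 + (G j ξ - DF j 0 ξ).2 := by
      rw [Prod.snd_sub, hsplit j ξ, Prod.snd_add]
      abel
    rw [heq]
    refine (norm_add₃_le.trans (add_le_add_three hCξ hDξ hR)).trans ?_
    nlinarith
  have hunstable (j : ℕ) (hj : j < n) (ξ : E × F) (hξ : ‖ξ‖ ≤ η) (u : E) (hu : ‖u‖ ≤ η) :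
      lam * ‖u - ((G j ξ).1 - (DF j 0 (ξ.1, 0)).1)‖ ≤ η := by
    have hR := (norm_fst_le _).trans (hremainder j hj ξ hξ)
    have hξ2 : ‖ξ.2‖ ≤ η := (norm_snd_le ξ).trans hξ
    have hBξ : ‖(DF j 0 (0, ξ.2)).1‖ ≤ (1 + lam - 2 * lamt) / 4 * η :=
      (ContinuousLinearMap.le_of_opNorm_le_of_le _ (hB j hj) hξ2)
    have heq : u - ((G j ξ).1 - (DF j 0 (ξ.1, 0)).1)
        = u + -(DF j 0 (0, ξ.2)).1 + -(G j ξ - DF j 0 ξ).1 := by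
      rw [Prod.fst_sub, hsplit j ξ, Prod.fst_add]
      abel
    have hnorm : ‖u - ((G j ξ).1 - (DF j 0 (ξ.1, 0)).1)‖ ≤ (7 - 3 * lamt) / 4 * η := by
      rw [heq]
      refine (norm_add₃_le.trans (add_le_add_three hu ((norm_neg _).trans_le hBξ)
        ((norm_neg _).trans_le hR))).trans ?_
      nlinarith
    calc lam * ‖u - ((G j ξ).1 - (DF j 0 (ξ.1, 0)).1)‖
        ≤ lamt * ((7 - 3 * lamt) / 4 * η) := by
          gcongr
          exact (h0.trans h1).le
      _ = (lamt * (7 - 3 * lamt) / 4) * η := by ring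
      _ ≤ 1 * η := by
          gcongr
          nlinarith
      _ = η := one_mul η
  have hinv (j : ℕ) : ∃ P : E →L[ℝ] E, j < n →
      (∀ x, (DF j 0 (P x, 0)).1 = x) ∧ ∀ x, ‖P x‖ ≤ lam * ‖x‖ := by
    by_cases hj : j < n
    · obtain ⟨P, hP⟩ := LinearMap.exists_rightInverse_of_le_norm
        ((ContinuousLinearMap.fst ℝ E F).comp
          ((DF j 0).comp (ContinuousLinearMap.inl ℝ E F))).toLinearMap h0 (hA j hj)
      exact ⟨P, fun _ => hP⟩
    · exact ⟨0, fun h => absurd h hj⟩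
  choose P hP using hinv
  let pt : (Fin (n + 1) → E × F) → ℕ → E × F := fun w k => w (Fin.ofNat (n + 1) k)
  have hptc (k : ℕ) : Continuous fun w => pt w k := continuous_apply _
  let Φ : (Fin (n + 1) → E × F) → Fin (n + 1) → E × F := fun w i =>
    (if (i : ℕ) < n then
        P i ((pt w (i + 1)).1 - ((G i (pt w i)).1 - (DF i 0 ((pt w i).1, 0)).1))
      else 0,
      if (i : ℕ) = 0 then 0 else (G (i - 1) (pt w (i - 1))).2)
  have hΦ : Continuous Φ := by
    refine continuous_pi fun i => Continuous.prodMk ?_ ?_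
    · split_ifs with hi
      · have hGi := hGcont i hi
        fun_prop
      · exact continuous_const
    · split_ifs with hi
      · exact continuous_const
      · have hGi := hGcont (i - 1) (by omega)
        fun_prop
  obtain ⟨w, hw, hfix⟩ := exists_fixedPoint_of_mapsTo_closedBall hΦ hη fun w hw => by
    rw [mem_closedBall_zero_iff] at hw ⊢
    have hpt (k : ℕ) : ‖pt w k‖ ≤ η := (norm_le_pi_norm w _).trans hw
    refine (pi_norm_le_iff_of_nonneg hη.le).mpr fun i => ?_
    refine norm_prod_le_iff.mpr ⟨?_, ?_⟩
    · by_cases hi : (i : ℕ) < n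
      · simp only [Φ, if_pos hi]
        exact ((hP i hi).2 _).trans
          (hunstable i hi _ (hpt _) _ ((norm_fst_le _).trans (hpt _)))
      · simpa [Φ, hi] using hη.le
    · by_cases hi : (i : ℕ) = 0
      · simpa [Φ, hi] using hη.le
      · simp only [Φ, if_neg hi]
        exact hstable _ (by omega) _ (hpt _)
  rw [mem_closedBall_zero_iff] at hw
  refine ⟨pt w, fun j _ => (norm_le_pi_norm w _).trans hw, fun j hj => Prod.ext ?_ ?_⟩
  · have h := congrArg Prod.fst (congrFun hfix (Fin.ofNat (n + 1) j))
    have hval : ((Fin.ofNat (n + 1) j : Fin (n + 1)) : ℕ) = j := Nat.mod_eq_of_lt (by omega)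
    simp only [Φ, hval, if_pos hj] at h
    change _ = (pt w j).1 at h
    have h' := (hP j hj).1 ((pt w (j + 1)).1 - ((G j (pt w j)).1 - (DF j 0 ((pt w j).1, 0)).1))
    rw [h, eq_comm, sub_eq_iff_eq_add, add_sub_cancel] at h'
    exact h'
  · have h := congrArg Prod.snd (congrFun hfix (Fin.ofNat (n + 1) (j + 1)))
    have hval : ((Fin.ofNat (n + 1) (j + 1) : Fin (n + 1)) : ℕ) = j + 1 :=
      Nat.mod_eq_of_lt (by omega)
    simp only [Φ, hval, Nat.add_one_ne_zero, if_false, Nat.add_sub_cancel] at h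
    exact h.symm
end

section
/- Let E and F be finite-dimensional real normed vector spaces, X = E × F with the sup norm, and let 0 < λ < λ̃ < (1+λ)/2 and η > 0. For each j ∈ ℤ let F_j : X → X be C¹ on the closed ball B̄(0,η) with blocks A_j, B_j, C_j, D_j of DF_j(0) satisfying ‖A_j v‖ ≥ λ^{-1}‖v‖ for all v ∈ E, ‖D_j‖ ≤ λ, ‖B_j‖ ≤ (1+λ−2λ̃)/4, ‖C_j‖ ≤ (1+λ−2λ̃)/4, and ‖DF_j(ξ) − DF_j(0)‖ ≤ (λ̃−λ)/4 for all ‖ξ‖ ≤ η; and let G_j : X → X be continuous maps and d, δ ≥ 0 numbers with ‖F_j(0)‖ ≤ δ, ‖G_j(ξ) − F_j(ξ)‖ ≤ d for all ‖ξ‖ ≤ η, and d + δ ≤ (1−λ̃)η/2. Then there exists a two-sided sequence (v_j)_{j ∈ ℤ} in X with ‖v_j‖ ≤ η for all j ∈ ℤ and v_{j+1} = G_j(v_j) for all j ∈ ℤ. -/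
section BrouwerFixedPoint

open MeasureTheory Measure Metric Set Module Polynomial
open scoped NNReal Manifold ContDiff

section LinearAlgebra

variable {V : Type*} [NormedAddCommGroup V] [NormedSpace ℝ V] [FiniteDimensional ℝ V]

/-- The determinant `det (1 + t A)` is a polynomial in `t` of degree at most `dim V`. -/
theorem exists_polynomial_eval_eq_det_one_add_smul (A : V →L[ℝ] V) :
    ∃ p : ℝ[X], p.natDegree ≤ finrank ℝ V ∧
      ∀ t : ℝ, p.eval t = (ContinuousLinearMap.id ℝ V + t • A).det := by
  let b := finBasis ℝ V
  let M := LinearMap.toMatrix b b (A : V →ₗ[ℝ] V)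
  refine ⟨((X : ℝ[X]) • M.map C + (1 : Matrix _ _ ℝ).map C).det, ?_, fun t => ?_⟩
  · simpa using natDegree_det_X_add_C_le M 1
  · have h : (ContinuousLinearMap.id ℝ V + t • A).det
        = (LinearMap.toMatrix b b
          ((ContinuousLinearMap.id ℝ V + t • A : V →L[ℝ] V) : V →ₗ[ℝ] V)).det := by
      rw [LinearMap.det_toMatrix]
    have h' : ((ContinuousLinearMap.id ℝ V + t • A : V →L[ℝ] V) : V →ₗ[ℝ] V)
        = LinearMap.id + t • (A : V →ₗ[ℝ] V) := rfl
    rw [h, h', map_add, map_smul, LinearMap.toMatrix_id, ← coe_evalRingHom, RingHom.map_det]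
    congr 1
    ext i j
    by_cases hij : i = j <;> simp [M, hij] <;> ring

/-- A perturbation of the identity by an operator of norm less than one has positive
determinant. -/
theorem det_id_add_pos (A : V →L[ℝ] V) (hA : ‖A‖ < 1) :
    0 < (ContinuousLinearMap.id ℝ V + A).det := by
  obtain ⟨p, -, hp⟩ := exists_polynomial_eval_eq_det_one_add_smul A
  have hne : ∀ t ∈ Icc (0 : ℝ) 1, p.eval t ≠ 0 := by
    intro t ht h
    rw [hp] at h
    obtain ⟨x, hx, hx0⟩ := Submodule.exists_mem_ne_zero_of_ne_bot
      (LinearMap.bot_lt_ker_of_det_eq_zero h).ne'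
    have hx : x + t • A x = 0 := hx
    have hxn : 0 < ‖x‖ := norm_pos_iff.2 hx0
    have h1 : ‖x‖ ≤ ‖A‖ * ‖x‖ := calc
      ‖x‖ = ‖t • A x‖ := by rw [← norm_neg (t • A x), ← eq_neg_of_add_eq_zero_left hx]
      _ = t * ‖A x‖ := by rw [norm_smul, Real.norm_eq_abs, abs_of_nonneg ht.1]
      _ ≤ 1 * ‖A x‖ := by gcongr; exact ht.2
      _ ≤ ‖A‖ * ‖x‖ := by rw [one_mul]; exact A.le_opNorm x
    nlinarith
  have h0 : p.eval 0 = 1 := by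
    rw [hp, zero_smul, add_zero]; exact LinearMap.det_id
  have h1 : p.eval 1 = (ContinuousLinearMap.id ℝ V + A).det := by rw [hp, one_smul]
  rw [← h1]
  by_contra! hle
  obtain ⟨t, ht, hpt⟩ := intermediate_value_Icc' zero_le_one p.continuous.continuousOn
    (show (0 : ℝ) ∈ Icc (p.eval 1) (p.eval 0) from ⟨hle, by simp [h0]⟩)
  exact hne t ht hpt

/-- Evaluation at `1` of `t ↦ det (1 + t A)` through its values at any `dim V + 1` nodes, with
weights independent of `A` and summing to one. -/
theorem exists_weights_det_id_add (v : Fin (finrank ℝ V + 1) → ℝ) (hv : Function.Injective v) :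
    ∃ w : Fin (finrank ℝ V + 1) → ℝ, ∑ i, w i = 1 ∧ ∀ A : V →L[ℝ] V,
      (ContinuousLinearMap.id ℝ V + A).det
        = ∑ i, w i * (ContinuousLinearMap.id ℝ V + v i • A).det := by
  refine ⟨fun i => (Lagrange.basis Finset.univ v i).eval 1, ?_, fun A => ?_⟩
  · rw [← eval_finsetSum, Lagrange.sum_basis hv.injOn Finset.univ_nonempty, eval_one]
  · obtain ⟨p, hdeg, hp⟩ := exists_polynomial_eval_eq_det_one_add_smul A
    have hlt : p.degree < (Finset.univ : Finset (Fin (finrank ℝ V + 1))).card := by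
      refine degree_le_natDegree.trans_lt ?_
      rw [Finset.card_fin]
      exact_mod_cast Nat.lt_succ_of_le hdeg
    have := congrArg (eval 1) (Lagrange.eq_interpolate hv.injOn hlt)
    rw [hp, one_smul, Lagrange.interpolate_apply, eval_finsetSum] at this
    simpa [hp, mul_comm] using this

end LinearAlgebra

section Brouwer

variable {V : Type*} [NormedAddCommGroup V] [NormedSpace ℝ V]

/-- A differentiable map of locally constant nonzero norm has a degenerate derivative. -/
theorem det_eq_zero_of_norm_eventually_eq [FiniteDimensional ℝ V] {ψ : V → V} {ψ' : V →L[ℝ] V}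
    {x : V} {R : ℝ}
    (hR : 0 < R) (hψ : HasFDerivAt ψ ψ' x) (hn : ∀ᶠ y in nhds x, ‖ψ y‖ = R) : ψ'.det = 0 := by
  by_contra hdet
  have hsurj : Function.Surjective ψ' := by
    have := (LinearMap.equivOfDetNeZero (ψ' : V →ₗ[ℝ] V) hdet).surjective
    exact this
  obtain ⟨w, hw⟩ := hsurj (ψ x)
  have hx : ‖ψ x‖ = R := hn.self_of_nhds
  have hline : HasDerivAt (fun t : ℝ => ψ (x + t • w)) (ψ x) 0 := by
    have h1 : HasDerivAt (fun t : ℝ => x + t • w) w 0 := by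
      simpa using ((hasDerivAt_id (0 : ℝ)).smul_const w).const_add x
    have h2 : HasFDerivAt ψ ψ' (x + (0 : ℝ) • w) := by simpa using hψ
    rw [← hw]
    exact h2.comp_hasDerivAt (0 : ℝ) h1
  have ho := (hasDerivAt_iff_isLittleO.1 hline).def (half_pos hR)
  have hcont : Filter.Tendsto (fun t : ℝ => x + t • w) (nhds 0) (nhds x) := by
    have : Continuous (fun t : ℝ => x + t • w) := by fun_prop
    simpa using this.tendsto 0
  obtain ⟨t, ⟨ht1, ht2⟩, ht0⟩ := ((ho.and (hcont.eventually hn)).filter_mono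
    nhdsWithin_le_nhds |>.and self_mem_nhdsWithin : ∀ᶠ t in nhdsWithin (0 : ℝ) (Ioi 0), _).exists
  have ht0 : 0 < t := ht0
  simp only [sub_zero, zero_smul, add_zero, Real.norm_eq_abs, abs_of_pos ht0] at ht1
  have h3 : ‖(1 + t) • ψ x‖ ≤ ‖ψ (x + t • w)‖ + ‖ψ (x + t • w) - ψ x - t • ψ x‖ := by
    have : (1 + t) • ψ x = ψ (x + t • w) - (ψ (x + t • w) - ψ x - t • ψ x) := by
      rw [add_smul, one_smul]; abel
    rw [this]
    exact norm_sub_le _ _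
  rw [norm_smul, Real.norm_eq_abs, abs_of_pos (by linarith), hx, ht2] at h3
  nlinarith

/-- A small Lipschitz perturbation of the identity supported in a ball maps that ball
bijectively to itself. -/
theorem image_ball_of_lipschitz_perturbation [CompleteSpace V] {g : V → V} {c : ℝ≥0} {R : ℝ}
    (hg : LipschitzWith c g) (hc : c < 1) (hsupp : ∀ x, R ≤ ‖x‖ → g x = 0) :
    Function.Injective (fun x => x + g x) ∧ (fun x => x + g x) '' ball 0 R = ball 0 R := by
  have happ : ApproximatesLinearOn (fun x => x + g x)
      ((ContinuousLinearEquiv.refl ℝ V : V ≃L[ℝ] V) : V →L[ℝ] V) univ c := by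
    intro x _ y _
    have := hg.dist_le_mul x y
    rw [dist_eq_norm, dist_eq_norm] at this
    have heq : x + g x - (y + g y) - (x - y) = g x - g y := by abel
    rw [← heq] at this
    exact this
  have hN : Subsingleton V ∨ c < ‖((ContinuousLinearEquiv.refl ℝ V : V ≃L[ℝ] V).symm :
      V →L[ℝ] V)‖₊⁻¹ := by
    rcases subsingleton_or_nontrivial V with h | h
    · exact Or.inl h
    · refine Or.inr ?_
      simpa using hc
  have hinj : Function.Injective (fun x => x + g x) := injOn_univ.1 (happ.injOn hN)
  have hsurj := happ.surjective hN
  refine ⟨hinj, ?_⟩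
  have hfix : (fun x => x + g x) '' (ball 0 R)ᶜ = (ball 0 R)ᶜ := by
    have : EqOn (fun x => x + g x) id (ball 0 R)ᶜ := fun x hx => by
      simp [hsupp x (by simpa using hx)]
    rw [this.image_eq, image_id]
  have := image_compl_eq (s := ball (0 : V) R) ⟨hinj, hsurj⟩
  rw [hfix] at this
  exact (compl_injective this).symm

/-- The Jacobian of a small Lipschitz perturbation of the
identity supported in a ball integrates to the volume of that ball. -/
theorem integral_det_id_add_of_lipschitz [FiniteDimensional ℝ V] [MeasurableSpace V]
    [BorelSpace V] {g : V → V} {g' : V → V →L[ℝ] V} {c : ℝ≥0} {R : ℝ} {D : Set V}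
    (hg : LipschitzWith c g) (hc : c < 1) (hsupp : ∀ x, R ≤ ‖x‖ → g x = 0)
    (hD : MeasurableSet D) (hDball : D ⊆ ball 0 R)
    (hnull : μH[finrank ℝ V] (ball (0 : V) R \ D) = 0)
    (hg' : ∀ x ∈ D, HasFDerivAt g (g' x) x) :
    IntegrableOn (fun x => (ContinuousLinearMap.id ℝ V + g' x).det) D μH[finrank ℝ V] ∧
      ∫ x in D, (ContinuousLinearMap.id ℝ V + g' x).det ∂μH[finrank ℝ V]
        = μH[finrank ℝ V].real (ball (0 : V) R) := by
  obtain ⟨hinj, himg⟩ := image_ball_of_lipschitz_perturbation hg hc hsupp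
  set φ : V → V := fun x => x + g x with hφ
  have hφlip : LipschitzWith (1 + c) φ := LipschitzWith.id.add hg
  have hφ' : ∀ x ∈ D, HasFDerivWithinAt φ (ContinuousLinearMap.id ℝ V + g' x) D x :=
    fun x hx => ((hasFDerivAt_id x).add (hg' x hx)).hasFDerivWithinAt
  have hpos : ∀ x ∈ D, 0 < (ContinuousLinearMap.id ℝ V + g' x).det := fun x hx =>
    det_id_add_pos _ (((hg' x hx).le_of_lipschitz hg).trans_lt (by exact_mod_cast hc))
  have hsub : φ '' D ⊆ ball 0 R := (image_mono hDball).trans himg.subset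
  have hdiff : μH[finrank ℝ V] (ball (0 : V) R \ φ '' D) = 0 := by
    have h1 : ball (0 : V) R \ φ '' D ⊆ φ '' (ball 0 R \ D) := by
      rw [image_sdiff hinj, himg]
    refine measure_mono_null h1 ?_
    have := hφlip.hausdorffMeasure_image_le (Nat.cast_nonneg (finrank ℝ V)) (ball 0 R \ D)
    rw [hnull, mul_zero] at this
    exact le_antisymm this zero_le
  have hvol : μH[finrank ℝ V] (φ '' D) = μH[finrank ℝ V] (ball (0 : V) R) :=
    le_antisymm (measure_mono hsub) (measure_mono_ae (ae_le_set.2 hdiff))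
  have hint := integrableOn_image_iff_integrableOn_abs_det_fderiv_smul μH[finrank ℝ V] hD hφ'
    hinj.injOn (fun _ => (1 : ℝ))
  have heq := integral_image_eq_integral_abs_det_fderiv_smul μH[finrank ℝ V] hD hφ'
    hinj.injOn (fun _ => (1 : ℝ))
  have habs : EqOn (fun x => |(ContinuousLinearMap.id ℝ V + g' x).det| • (1 : ℝ))
      (fun x => (ContinuousLinearMap.id ℝ V + g' x).det) D := fun x hx => by
    simp [abs_of_pos (hpos x hx)]
  rw [integrableOn_congr_fun habs hD] at hint
  rw [setIntegral_congr_fun hD habs] at heq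
  refine ⟨hint.1 (integrableOn_const ?_), ?_⟩
  · rw [hvol]; exact measure_ball_lt_top.ne
  · rw [← heq]
    simp [measureReal_def, hvol]

/-- There is no Lipschitz retraction of a ball onto its boundary sphere. -/
theorem not_lipschitz_retraction [FiniteDimensional ℝ V] {ψ : V → V} {K : ℝ≥0} {R : ℝ}
    (hR : 0 < R) (hψ : LipschitzWith K ψ) (hfix : ∀ x, R ≤ ‖x‖ → ψ x = x)
    (hsphere : ∀ x, ‖x‖ < R → ‖ψ x‖ = R) : False := by
  borelize V
  set μ : Measure V := μH[finrank ℝ V] with hμ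
  set g : V → V := fun x => ψ x - x with hg
  have hglip : LipschitzWith (K + 1) g := hψ.sub LipschitzWith.id
  set D : Set V := ball 0 R ∩ {x | DifferentiableAt ℝ g x} with hD
  have hDm : MeasurableSet D := measurableSet_ball.inter (measurableSet_of_differentiableAt ℝ g)
  have hnull : μ (ball 0 R \ D) = 0 := by
    refine measure_mono_null ?_ (ae_iff.1 (hglip.ae_differentiableAt (μ := μ)))
    rintro x ⟨hx, hxD⟩ hd
    exact hxD ⟨hx, hd⟩
  let ε : ℝ := ((K : ℝ) + 2)⁻¹
  have hε : 0 < ε := by positivity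
  let v : Fin (finrank ℝ V + 1) → ℝ := fun i => ε / ((i : ℝ) + 1)
  have hv : Function.Injective v := by
    intro i j hij
    have hi : ((i : ℕ) : ℝ) + 1 ≠ 0 := by positivity
    have hj : ((j : ℕ) : ℝ) + 1 ≠ 0 := by positivity
    simp only [v, div_eq_div_iff hi hj] at hij
    have := mul_left_cancel₀ hε.ne' hij
    exact Fin.ext (by exact_mod_cast (add_right_cancel this).symm)
  have hkey : ∀ i, IntegrableOn (fun x => (ContinuousLinearMap.id ℝ V + v i • fderiv ℝ g x).det)
      D μ ∧ ∫ x in D, (ContinuousLinearMap.id ℝ V + v i • fderiv ℝ g x).det ∂μ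
        = μ.real (ball (0 : V) R) := by
    intro i
    have hvi : ‖v i‖ * (K + 1) < 1 := by
      have h1 : 0 ≤ v i := by positivity
      have h2 : v i ≤ ε := div_le_self hε.le (by simp)
      have h3 : ε * (K + 2) = 1 := inv_mul_cancel₀ (by positivity)
      rw [Real.norm_of_nonneg h1]
      nlinarith [K.2, mul_le_mul_of_nonneg_right h2 (by positivity : (0 : ℝ) ≤ K + 1)]
    refine integral_det_id_add_of_lipschitz (g := fun x => v i • g x) (c := ‖v i‖₊ * (K + 1))
      ?_ (by exact_mod_cast hvi) ?_ hDm inter_subset_left hnull ?_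
    · refine LipschitzWith.of_dist_le_mul fun x y => ?_
      rw [dist_smul₀, NNReal.coe_mul, coe_nnnorm, mul_assoc]
      exact mul_le_mul_of_nonneg_left (hglip.dist_le_mul x y) (norm_nonneg _)
    · intro x hx
      simp [hg, hfix x hx]
    · intro x hx
      exact hx.2.hasFDerivAt.const_smul (v i)
  obtain ⟨w, hw, hdet⟩ := exists_weights_det_id_add v hv
  have hzero : ∫ x in D, (ContinuousLinearMap.id ℝ V + fderiv ℝ g x).det ∂μ = 0 := by
    rw [setIntegral_congr_fun (g := fun _ => (0 : ℝ)) hDm, integral_zero]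
    intro x hx
    have h1 : HasFDerivAt ψ (ContinuousLinearMap.id ℝ V + fderiv ℝ g x) x := by
      have := (hasFDerivAt_id x).add hx.2.hasFDerivAt
      refine this.congr_of_eventuallyEq (Filter.Eventually.of_forall fun y => ?_)
      simp [hg]
    refine det_eq_zero_of_norm_eventually_eq hR h1 ?_
    filter_upwards [isOpen_ball.mem_nhds hx.1] with y hy
    exact hsphere y (by simpa using hy)
  have hsum : (fun x => (ContinuousLinearMap.id ℝ V + fderiv ℝ g x).det) = fun x =>
      ∑ i, w i * (ContinuousLinearMap.id ℝ V + v i • fderiv ℝ g x).det := funext fun x => hdet _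
  rw [hsum] at hzero
  rw [integral_finsetSum _ fun i _ => (hkey i).1.const_mul (w i)] at hzero
  simp_rw [integral_const_mul, (hkey _).2, ← Finset.sum_mul, hw, one_mul] at hzero
  have : 0 < μ.real (ball (0 : V) R) :=
    ENNReal.toReal_pos (measure_ball_pos μ 0 hR).ne' measure_ball_lt_top.ne
  exact this.ne' hzero

/-- Pushing the points of a ball radially to its boundary is Lipschitz away from the centre. -/
theorem lipschitzOnWith_radial_push {c R : ℝ} (hc : 0 < c) (hcR : c ≤ R) :
    ∃ K : ℝ≥0, LipschitzOnWith K (fun y : V => max 1 (R / ‖y‖) • y) {y | c ≤ ‖y‖} := by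
  have hR : 0 < R := hc.trans_le hcR
  let a : V → ℝ := fun y => max 1 (R / ‖y‖)
  have ha : ∀ y z : V, c ≤ ‖y‖ → c ≤ ‖z‖ → |a y - a z| ≤ R / c ^ 2 * ‖y - z‖ := by
    intro y z hy hz
    have hy0 : 0 < ‖y‖ := hc.trans_le hy
    have hz0 : 0 < ‖z‖ := hc.trans_le hz
    calc |a y - a z| ≤ |R / ‖y‖ - R / ‖z‖| := by
          simpa [a] using abs_max_sub_max_le_max 1 (R / ‖y‖) 1 (R / ‖z‖)
      _ = R / (‖y‖ * ‖z‖) * |‖z‖ - ‖y‖| := by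
          have h1 : R / ‖y‖ - R / ‖z‖ = R / (‖y‖ * ‖z‖) * (‖z‖ - ‖y‖) := by field_simp
          rw [h1, abs_mul, abs_of_pos (show 0 < R / (‖y‖ * ‖z‖) by positivity)]
      _ ≤ R / c ^ 2 * ‖y - z‖ := by
          rw [norm_sub_rev]
          gcongr
          · rw [sq]; gcongr
          · exact abs_norm_sub_norm_le z y
  have hb : ∀ y z : V, c ≤ ‖y‖ → c ≤ ‖z‖ → ‖y‖ ≤ R →
      ‖a y • y - a z • z‖ ≤ (R / c ^ 2 * R + R / c) * ‖y - z‖ := by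
    intro y z hy hz hyR
    have hz0 : 0 < ‖z‖ := hc.trans_le hz
    have haz : |a z| ≤ R / c := by
      rw [abs_of_nonneg (le_max_of_le_left zero_le_one)]
      refine max_le ((one_le_div hc).2 hcR) ?_
      gcongr
    calc ‖a y • y - a z • z‖ = ‖(a y - a z) • y + a z • (y - z)‖ := by
          rw [sub_smul, smul_sub]; abel_nf
      _ ≤ |a y - a z| * ‖y‖ + |a z| * ‖y - z‖ := by
          refine (norm_add_le _ _).trans ?_
          rw [norm_smul, norm_smul, Real.norm_eq_abs, Real.norm_eq_abs]
      _ ≤ R / c ^ 2 * ‖y - z‖ * R + R / c * ‖y - z‖ := by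
          gcongr
          exact ha y z hy hz
      _ = _ := by ring
  refine ⟨⟨R / c ^ 2 * R + R / c + 1, by positivity⟩, LipschitzOnWith.of_dist_le_mul ?_⟩
  intro y hy z hz
  simp only [dist_eq_norm]
  change ‖a y • y - a z • z‖ ≤ (R / c ^ 2 * R + R / c + 1) * ‖y - z‖
  have hn := norm_nonneg (y - z)
  rcases le_total ‖y‖ R with hyR | hyR
  · linarith [hb y z hy hz hyR]
  rcases le_total ‖z‖ R with hzR | hzR
  · have := hb z y hz hy hzR
    rw [norm_sub_rev, norm_sub_rev z y] at this
    linarith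
  · have h1 : ∀ u : V, R ≤ ‖u‖ → a u = 1 := fun u hu =>
      max_eq_left ((div_le_one (hR.trans_le hu)).2 hu)
    rw [h1 y hyR, h1 z hzR, one_smul, one_smul]
    have : 0 ≤ (R / c ^ 2 * R + R / c) * ‖y - z‖ := by positivity
    linarith

/-- **Brouwer's fixed point theorem** for bounded continuous self-maps of a finite-dimensional
real normed space. -/
theorem exists_fixedPoint_of_continuous_of_bounded [FiniteDimensional ℝ V] {f : V → V} {M : ℝ}
    (hf : Continuous f) (hM : ∀ x, ‖f x‖ ≤ M) : ∃ x, f x = x := by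
  by_contra! hne
  have hM0 : 0 ≤ M := (norm_nonneg _).trans (hM 0)
  obtain ⟨c, hc0, hc1, hc⟩ : ∃ c : ℝ, 0 < c ∧ c ≤ 1 ∧
      ∀ x : V, ‖x‖ ≤ M + 3 → c ≤ ‖x - f x‖ := by
    obtain ⟨x₀, -, hx₀⟩ := (isCompact_closedBall (0 : V) (M + 3)).exists_isMinOn
      ⟨0, by simp; linarith⟩ (f := fun x => ‖x - f x‖) (by fun_prop)
    refine ⟨min 1 ‖x₀ - f x₀‖, lt_min one_pos (norm_pos_iff.2 (sub_ne_zero.2 (hne x₀).symm)),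
      min_le_left _ _, fun x hx => (min_le_right _ _).trans (hx₀ (by simpa using hx))⟩
  obtain ⟨h, hh⟩ := exists_contMDiffMap_forall_mem_convex_of_local_const (n := ⊤) 𝓘(ℝ, V)
    (t := fun x => ball (f x) (c / 2)) (fun x => convex_ball _ _) (fun x => ⟨f x, by
      filter_upwards [hf.continuousAt.eventually (ball_mem_nhds (f x) (half_pos hc0))] with y hy
      rwa [mem_ball_comm]⟩)
  have hhM : ∀ x, ‖h x‖ ≤ M + 1 := by
    intro x
    have h1 := hh x
    rw [mem_ball, dist_eq_norm] at h1
    have := norm_le_norm_add_norm_sub' (h x) (f x)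
    linarith [hM x]
  let χ : ContDiffBump (0 : V) := ⟨M + 2, M + 3, by linarith, by linarith⟩
  have hχ0 : ∀ x : V, M + 3 ≤ ‖x‖ → χ x = 0 := fun x hx =>
    χ.zero_of_le_dist (by simpa using hx)
  obtain ⟨L, hL⟩ : ∃ L, LipschitzWith L (fun x => χ x • h x) :=
    ContDiff.lipschitzWith_of_hasCompactSupport (𝕂 := ℝ) (n := ∞) χ.hasCompactSupport.smul_right
      (χ.contDiff.smul h.contMDiff.contDiff) (by simp)
  have hχM : ∀ x, ‖χ x • h x‖ ≤ M + 1 := fun x => by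
    rw [norm_smul, Real.norm_of_nonneg χ.nonneg]
    exact (mul_le_of_le_one_left (norm_nonneg _) χ.le_one).trans (hhM x)
  set φ : V → V := fun x => x - χ x • h x with hφ
  have hφlip : LipschitzWith (1 + L) φ := LipschitzWith.id.sub hL
  have hφc : ∀ x, c / 2 ≤ ‖φ x‖ := by
    intro x
    rcases le_or_gt ‖x‖ (M + 2) with hx | hx
    · have h1 : χ x = 1 := χ.one_of_mem_closedBall (by simpa using hx)
      have h2 := hh x
      rw [mem_ball, dist_eq_norm] at h2
      have h3 := hc x (by linarith)
      have h4 : x - f x = φ x + (h x - f x) := by simp [hφ, h1]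
      have := norm_add_le (φ x) (h x - f x)
      rw [← h4] at this
      linarith
    · have := norm_sub_norm_le x (χ x • h x)
      linarith [hχM x]
  have hφid : ∀ x, M + 3 ≤ ‖x‖ → φ x = x := fun x hx => by simp [hφ, hχ0 x hx]
  set R : ℝ := 2 * M + 5 with hR
  obtain ⟨K, hK⟩ := lipschitzOnWith_radial_push (V := V) (half_pos hc0)
    (show c / 2 ≤ R by linarith)
  refine not_lipschitz_retraction (ψ := (fun y : V => max 1 (R / ‖y‖) • y) ∘ φ) (R := R)
    (by linarith) (lipschitzOnWith_univ.1
      (hK.comp hφlip.lipschitzOnWith fun x _ => hφc x)) ?_ ?_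
  · intro x hx
    rw [Function.comp_apply, hφid x (by linarith), max_eq_left, one_smul]
    exact (div_le_one (by linarith)).2 hx
  · intro x hx
    have h0 : 0 < ‖φ x‖ := (half_pos hc0).trans_le (hφc x)
    have h1 : ‖φ x‖ ≤ R := by
      by_contra! hlt
      have h2 : ‖φ x‖ ≤ ‖x‖ + ‖χ x • h x‖ := norm_sub_le _ _
      rw [hφid x (by linarith [hχM x])] at hlt
      linarith
    rw [Function.comp_apply, max_eq_right ((one_le_div h0).2 h1), norm_smul,
      Real.norm_of_nonneg (by positivity), div_mul_cancel₀ _ h0.ne']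

/-- Fixed points of a continuous self-map of a product of closed balls. -/
theorem exists_fixedPoint_pi_closedBall [FiniteDimensional ℝ V] {ι : Type*} {η : ℝ} (hη : 0 < η)
    {T : (ι → V) → ι → V} (hT : Continuous T)
    (hmaps : ∀ x : ι → V, (∀ i, ‖x i‖ ≤ η) → ∀ i, ‖T x i‖ ≤ η) :
    ∃ x : ι → V, (∀ i, ‖x i‖ ≤ η) ∧ T x = x := by
  classical
  let r : V → V := fun x => (η / max η ‖x‖) • x
  have hpos : ∀ x : V, 0 < max η ‖x‖ := fun x => hη.trans_le (le_max_left _ _)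
  have hr : Continuous r := by
    refine Continuous.smul (continuous_const.div (by fun_prop) fun x => (hpos x).ne') continuous_id
  have hrη : ∀ x, ‖r x‖ ≤ η := by
    intro x
    rw [norm_smul, Real.norm_of_nonneg (div_nonneg hη.le (hpos x).le), div_mul_eq_mul_div,
      div_le_iff₀ (hpos x)]
    exact mul_le_mul_of_nonneg_left (le_max_right _ _) hη.le
  have hrid : ∀ x, ‖x‖ ≤ η → r x = x := by
    intro x hx
    simp only [r]
    rw [max_eq_left hx, div_self hη.ne', one_smul]
  have hcompact : IsCompact (univ.pi fun _ : ι => closedBall (0 : V) η) :=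
    isCompact_univ_pi fun _ => isCompact_closedBall 0 η
  have hclosed : ∀ i, IsClosed {x : ι → V | T x i = x i} := fun i =>
    isClosed_eq ((continuous_apply i).comp hT) (continuous_apply i)
  obtain ⟨x, hx, hfix⟩ := hcompact.inter_iInter_nonempty _ hclosed fun S => by
    let ext : (S → V) → ι → V := fun w i => if hi : i ∈ S then r (w ⟨i, hi⟩) else 0
    have hext : Continuous ext := continuous_pi fun i => by
      by_cases hi : i ∈ S
      · simp only [ext, hi, dite_true]
        exact hr.comp (continuous_apply _)
      · simpa [ext, hi] using continuous_const
    have hextη : ∀ w i, ‖ext w i‖ ≤ η := fun w i => by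
      by_cases hi : i ∈ S
      · simpa [ext, hi] using hrη _
      · simpa [ext, hi] using hη.le
    obtain ⟨w, hw⟩ := exists_fixedPoint_of_continuous_of_bounded (M := η)
      (f := fun (w : S → V) (i : S) => T (ext w) i)
      (continuous_pi fun i => (continuous_apply (i : ι)).comp (hT.comp hext))
      (fun w => (pi_norm_le_iff_of_nonneg hη.le).2 fun i => hmaps _ (hextη w) i)
    refine ⟨ext w, fun i _ => by simpa using hextη w i, ?_⟩
    simp only [mem_iInter, mem_ofPred_eq]
    intro i hi
    have h1 : T (ext w) i = w ⟨i, hi⟩ := congrFun hw ⟨i, hi⟩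
    have h2 : ext w i = r (w ⟨i, hi⟩) := by simp [ext, hi]
    rw [h2, hrid, h1]
    rw [← h1]
    exact hmaps _ (hextη w) i
  exact ⟨x, fun i => by simpa using hx i (mem_univ i),
    funext fun i => mem_iInter.1 hfix i⟩

end Brouwer

end BrouwerFixedPoint

/-- An expanding endomorphism of a finite-dimensional space is invertible with contracting
inverse. -/
theorem exists_continuousLinearEquiv_of_expanding {E : Type*} [NormedAddCommGroup E]
    [NormedSpace ℝ E] [FiniteDimensional ℝ E] {lam : ℝ} (h0 : 0 < lam) (A : E →L[ℝ] E)
    (hA : ∀ v, lam⁻¹ * ‖v‖ ≤ ‖A v‖) :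
    ∃ e : E ≃L[ℝ] E, (∀ v, e v = A v) ∧ ∀ w, ‖e.symm w‖ ≤ lam * ‖w‖ := by
  have hinj : Function.Injective (A : E →ₗ[ℝ] E) := by
    refine (injective_iff_map_eq_zero _).2 fun v hv => ?_
    have h1 : A v = 0 := hv
    have h2 := hA v
    rw [h1, norm_zero] at h2
    have h3 : 0 < lam⁻¹ := inv_pos.2 h0
    exact norm_le_zero_iff.1 (by nlinarith [norm_nonneg v])
  let e : E ≃L[ℝ] E := (LinearEquiv.ofInjectiveEndo _ hinj).toContinuousLinearEquiv
  have he : ∀ v, e v = A v := fun v => rfl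
  refine ⟨e, he, fun w => ?_⟩
  have := hA (e.symm w)
  rw [← he, e.apply_symm_apply] at this
  exact (inv_mul_le_iff₀ h0).1 this

/-- Theorem 4.1 (local chart form of infinite bi-shadowing): under uniform
semi-hyperbolicity bounds on the local maps F_j (j ∈ ℤ) and smallness of the
perturbations G_j and of the jumps F_j(0), there is a full two-sided orbit of
the maps G_j staying in the closed η-ball. -/
theorem infinite_bi_shadowing_local
    {E F : Type*} [NormedAddCommGroup E] [NormedSpace ℝ E]
    [NormedAddCommGroup F] [NormedSpace ℝ F]
    [FiniteDimensional ℝ E] [FiniteDimensional ℝ F]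
    (lam lamt η d δ : ℝ) (h0 : 0 < lam) (h1 : lam < lamt)
    (h2 : lamt < (1 + lam) / 2) (hη : 0 < η) (hd : 0 ≤ d) (hδ : 0 ≤ δ)
    (Fmap : ℤ → E × F → E × F) (DF : ℤ → E × F → (E × F) →L[ℝ] E × F)
    (G : ℤ → E × F → E × F)
    (hderiv : ∀ j : ℤ, ∀ ξ ∈ Metric.closedBall (0 : E × F) η,
      HasFDerivAt (Fmap j) (DF j ξ) ξ)
    (hcont : ∀ j : ℤ, ContinuousOn (DF j) (Metric.closedBall (0 : E × F) η))
    (hA : ∀ j : ℤ, ∀ v : E, lam⁻¹ * ‖v‖ ≤ ‖(DF j 0 (v, 0)).1‖)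
    (hD : ∀ j : ℤ, ‖(ContinuousLinearMap.snd ℝ E F).comp
        ((DF j 0).comp (ContinuousLinearMap.inr ℝ E F))‖ ≤ lam)
    (hB : ∀ j : ℤ, ‖(ContinuousLinearMap.fst ℝ E F).comp
        ((DF j 0).comp (ContinuousLinearMap.inr ℝ E F))‖ ≤ (1 + lam - 2 * lamt) / 4)
    (hC : ∀ j : ℤ, ‖(ContinuousLinearMap.snd ℝ E F).comp
        ((DF j 0).comp (ContinuousLinearMap.inl ℝ E F))‖ ≤ (1 + lam - 2 * lamt) / 4)
    (hclose : ∀ j : ℤ, ∀ ξ : E × F, ‖ξ‖ ≤ η → ‖DF j ξ - DF j 0‖ ≤ (lamt - lam) / 4)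
    (hGcont : ∀ j : ℤ, Continuous (G j))
    (hF0 : ∀ j : ℤ, ‖Fmap j 0‖ ≤ δ)
    (hGF : ∀ j : ℤ, ∀ ξ : E × F, ‖ξ‖ ≤ η → ‖G j ξ - Fmap j ξ‖ ≤ d)
    (hsum : d + δ ≤ (1 - lamt) * η / 2) :
    ∃ v : ℤ → E × F, (∀ j : ℤ, ‖v j‖ ≤ η) ∧
      ∀ j : ℤ, v (j + 1) = G j (v j) := by
  choose e he hsymm using fun j => exists_continuousLinearEquiv_of_expanding h0
    ((ContinuousLinearMap.fst ℝ E F).comp ((DF j 0).comp (ContinuousLinearMap.inl ℝ E F)))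
    (by simpa using hA j)
  have hdecomp : ∀ j (ξ : E × F), DF j 0 ξ = DF j 0 (ξ.1, 0) + DF j 0 (0, ξ.2) := fun j ξ => by
    rw [← map_add]; simp
  have hrem : ∀ j (ξ : E × F), ‖ξ‖ ≤ η →
      ‖G j ξ - DF j 0 ξ‖ ≤ (1 - lamt) * η / 2 + (lamt - lam) / 4 * η := by
    intro j ξ hξ
    have hmv : ‖Fmap j ξ - Fmap j 0 - DF j 0 (ξ - 0)‖ ≤ (lamt - lam) / 4 * ‖ξ - 0‖ :=
      (convex_closedBall (0 : E × F) η).norm_image_sub_le_of_norm_hasFDerivWithin_le'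
        (fun x hx => (hderiv j x hx).hasFDerivWithinAt)
        (fun x hx => hclose j x (by simpa using hx)) (by simpa using hη.le) (by simpa using hξ)
    rw [sub_zero] at hmv
    have h3 : G j ξ - DF j 0 ξ
        = (G j ξ - Fmap j ξ) + (Fmap j ξ - Fmap j 0 - DF j 0 ξ) + Fmap j 0 := by abel
    have h4 : (lamt - lam) / 4 * ‖ξ‖ ≤ (lamt - lam) / 4 * η :=
      mul_le_mul_of_nonneg_left hξ (by linarith)
    rw [h3]
    have := norm_add₃_le (a := G j ξ - Fmap j ξ) (b := Fmap j ξ - Fmap j 0 - DF j 0 ξ)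
      (c := Fmap j 0)
    linarith [hGF j ξ hξ, hF0 j]
  have hfst : ∀ j (ξ : E × F), ‖ξ‖ ≤ η → ‖(G j ξ).1 - e j ξ.1‖ ≤ 3 / 4 * (1 - lamt) * η := by
    intro j ξ hξ
    have h3 : (G j ξ).1 - e j ξ.1 = (G j ξ - DF j 0 ξ).1 + (DF j 0 (0, ξ.2)).1 := by
      rw [he, hdecomp j ξ]
      simp only [ContinuousLinearMap.comp_apply, ContinuousLinearMap.inl_apply,
        ContinuousLinearMap.coe_fst', Prod.fst_sub, Prod.fst_add]
      abel
    have h4 : ‖(DF j 0 (0, ξ.2)).1‖ ≤ (1 + lam - 2 * lamt) / 4 * η :=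
      ContinuousLinearMap.le_of_opNorm_le_of_le _ (hB j) ((norm_snd_le ξ).trans hξ)
    rw [h3]
    linarith [norm_add_le (G j ξ - DF j 0 ξ).1 (DF j 0 (0, ξ.2)).1, hrem j ξ hξ,
      norm_fst_le (G j ξ - DF j 0 ξ)]
  have hsnd : ∀ j (ξ : E × F), ‖ξ‖ ≤ η → ‖(G j ξ).2‖ ≤ η := by
    intro j ξ hξ
    have h3 : (G j ξ).2 = (G j ξ - DF j 0 ξ).2 + (DF j 0 (ξ.1, 0)).2 + (DF j 0 (0, ξ.2)).2 := by
      rw [hdecomp j ξ]; simp [add_assoc]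
    have h4 : ‖(DF j 0 (ξ.1, 0)).2‖ ≤ (1 + lam - 2 * lamt) / 4 * η :=
      ContinuousLinearMap.le_of_opNorm_le_of_le _ (hC j) ((norm_fst_le ξ).trans hξ)
    have h5 : ‖(DF j 0 (0, ξ.2)).2‖ ≤ lam * η :=
      ContinuousLinearMap.le_of_opNorm_le_of_le _ (hD j) ((norm_snd_le ξ).trans hξ)
    have h6 := norm_add₃_le (a := (G j ξ - DF j 0 ξ).2) (b := (DF j 0 (ξ.1, 0)).2)
      (c := (DF j 0 (0, ξ.2)).2)
    rw [h3]
    nlinarith [hrem j ξ hξ, norm_snd_le (G j ξ - DF j 0 ξ)]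
  -- The fixed points of `T` are the orbits: the expanding coordinate is solved backwards in time.
  let T : (ℤ → E × F) → ℤ → E × F := fun v j =>
    ((e j).symm ((v (j + 1)).1 - ((G j (v j)).1 - e j (v j).1)), (G (j - 1) (v (j - 1))).2)
  have hT : Continuous T := by
    refine continuous_pi fun j => ?_
    have h1 := hGcont j
    have h2 := hGcont (j - 1)
    fun_prop
  obtain ⟨v, hvη, hv⟩ := exists_fixedPoint_pi_closedBall hη hT fun v hv j => by
    refine max_le ?_ (hsnd _ _ (hv _))
    have h3 : ‖(v (j + 1)).1 - ((G j (v j)).1 - e j (v j).1)‖ ≤ η + 3 / 4 * (1 - lamt) * η :=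
      (norm_sub_le _ _).trans
        (add_le_add ((norm_fst_le _).trans (hv _)) (hfst j (v j) (hv j)))
    refine (hsymm j _).trans ((mul_le_mul_of_nonneg_left h3 h0.le).trans ?_)
    have h4 : lam * (1 + 3 / 4 * (1 - lamt)) ≤ 1 := by nlinarith
    nlinarith
  refine ⟨v, hvη, fun j => Prod.ext ?_ ?_⟩
  · have h3 : (e j).symm ((v (j + 1)).1 - ((G j (v j)).1 - e j (v j).1)) = (v j).1 :=
      congrArg Prod.fst (congrFun hv j)
    rw [ContinuousLinearEquiv.symm_apply_eq, sub_eq_iff_eq_add] at h3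
    rw [h3]
    abel
  · have h3 : (T v (j + 1)).2 = (v (j + 1)).2 := congrArg Prod.snd (congrFun hv (j + 1))
    simp only [T, add_sub_cancel_right] at h3
    exact h3.symm
end

section
/- Let E and F be finite-dimensional real normed vector spaces, X = E × F with the sup norm, and let 0 < λ < λ̃ < (1+λ)/2 and η > 0. For each j ∈ ℤ let F_j : X → X be C¹ on the closed ball B̄(0,η) with blocks A_j, B_j, C_j, D_j of DF_j(0) satisfying ‖A_j v‖ ≥ λ^{-1}‖v‖ for all v ∈ E, ‖D_j‖ ≤ λ, ‖B_j‖ ≤ (1+λ−2λ̃)/4, ‖C_j‖ ≤ (1+λ−2λ̃)/4, and ‖DF_j(ξ) − DF_j(0)‖ ≤ (λ̃−λ)/4 for all ‖ξ‖ ≤ η; let G_j : X → X be continuous maps and d, δ ≥ 0 numbers with ‖F_j(0)‖ ≤ δ, ‖G_j(ξ) − F_j(ξ)‖ ≤ d for all ‖ξ‖ ≤ η, and d + δ ≤ (1−λ̃)η/2. Assume moreover that the data are periodic: there is a positive integer N with F_{j+N} = F_j and G_{j+N} = G_j for all j ∈ ℤ. Then there exists a periodic two-sided sequence (v_j)_{j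 ∈ ℤ} in X with ‖v_j‖ ≤ η, v_{j+1} = G_j(v_j), and v_{j+N} = v_j for all j ∈ ℤ. -/
open Metric MeasureTheory Set

section Brouwer

/-- `det (1 + t M)` is a polynomial in `t` of degree at most the dimension, so its value at `1` is
given by Lagrange interpolation. -/
theorem det_id_add_eq_sum_lagrange {V : Type*} [NormedAddCommGroup V] [NormedSpace ℝ V]
    [FiniteDimensional ℝ V] (t : ℕ → ℝ) (ht : Function.Injective t) (M : V →L[ℝ] V) :
    (ContinuousLinearMap.id ℝ V + M).det =
      ∑ i ∈ Finset.range (Module.finrank ℝ V + 1),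
        (Lagrange.basis (Finset.range (Module.finrank ℝ V + 1)) t i).eval 1 *
          (ContinuousLinearMap.id ℝ V + t i • M).det := by
  classical
  let b := Module.finBasis ℝ V
  let A := LinearMap.toMatrix b b (M : V →ₗ[ℝ] V)
  let P : Polynomial ℝ := Matrix.det
    ((Polynomial.X : Polynomial ℝ) • A.map Polynomial.C +
      (1 : Matrix (Fin (Module.finrank ℝ V)) (Fin (Module.finrank ℝ V)) ℝ).map Polynomial.C)
  have hP : ∀ s : ℝ, P.eval s = (ContinuousLinearMap.id ℝ V + s • M).det := by
    intro s
    rw [ContinuousLinearMap.det, ← LinearMap.det_toMatrix b, ← Polynomial.coe_evalRingHom,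
      RingHom.map_det]
    congr 1
    ext i j
    rcases eq_or_ne i j with rfl | h
    · simp [A, LinearMap.toMatrix_apply]
      ring
    · simp [A, LinearMap.toMatrix_apply, h]
      ring
  have hdeg : P.degree < (Finset.range (Module.finrank ℝ V + 1)).card := by
    refine lt_of_le_of_lt Polynomial.degree_le_natDegree ?_
    have := Polynomial.natDegree_det_X_add_C_le A 1
    simp only [Fintype.card_fin] at this
    rw [Finset.card_range]
    exact_mod_cast Nat.lt_succ_of_le this
  have h := Lagrange.eq_interpolate (v := t) ht.injOn hdeg
  have h1 := congrArg (Polynomial.eval 1) h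
  rw [hP, one_smul, Lagrange.interpolate_apply, Polynomial.eval_finsetSum] at h1
  rw [h1]
  refine Finset.sum_congr rfl fun i _ => ?_
  rw [Polynomial.eval_mul, Polynomial.eval_C, hP, mul_comm]

theorem ContinuousLinearMap.bijective_id_add_of_norm_lt_one {V : Type*} [NormedAddCommGroup V]
    [NormedSpace ℝ V] [CompleteSpace V] {M : V →L[ℝ] V} (hM : ‖M‖ < 1) :
    Function.Bijective (ContinuousLinearMap.id ℝ V + M) := by
  have h := isUnit_one_sub_of_norm_lt_one (x := -M) (by simpa using hM)
  rw [sub_neg_eq_add] at h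
  exact (ContinuousLinearMap.isUnit_iff_bijective).1 h

theorem ContinuousLinearMap.det_id_add_pos {V : Type*} [NormedAddCommGroup V]
    [NormedSpace ℝ V] [FiniteDimensional ℝ V] {M : V →L[ℝ] V} (hM : ‖M‖ < 1) :
    0 < (ContinuousLinearMap.id ℝ V + M).det := by
  have := FiniteDimensional.complete ℝ V
  have hne : ∀ s ∈ Icc (0 : ℝ) 1, (ContinuousLinearMap.id ℝ V + s • M).det ≠ 0 := by
    intro s hs h
    have hb : Function.Bijective (ContinuousLinearMap.id ℝ V + s • M) := by
      apply ContinuousLinearMap.bijective_id_add_of_norm_lt_one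
      rw [norm_smul, Real.norm_of_nonneg hs.1]
      nlinarith [hs.2, norm_nonneg M]
    have := LinearMap.bot_lt_ker_of_det_eq_zero h
    rw [LinearMap.ker_eq_bot.2 hb.1] at this
    exact lt_irrefl _ this
  have hc : Continuous fun s : ℝ => (ContinuousLinearMap.id ℝ V + s • M).det :=
    ContinuousLinearMap.continuous_det.comp (by fun_prop)
  by_contra! hle
  obtain ⟨s, hs, h⟩ := intermediate_value_Icc' zero_le_one hc.continuousOn
    (show (0 : ℝ) ∈ Icc _ _ by
      refine ⟨by simpa using hle, ?_⟩
      simp [ContinuousLinearMap.det])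
  exact hne s hs h

variable {H : Type*} [NormedAddCommGroup H] [InnerProductSpace ℝ H] [FiniteDimensional ℝ H]

theorem det_eq_zero_of_norm_eventually_eq_one {r : H → H} {r' : H →L[ℝ] H} {x : H}
    (hr : HasFDerivAt r r' x) (h : ∀ᶠ y in nhds x, ‖r y‖ = 1) : r'.det = 0 := by
  by_contra hdet
  have h1 := hr.norm_sq
  have h2 : HasFDerivAt (fun y => ‖r y‖ ^ 2) (0 : H →L[ℝ] ℝ) x :=
    (hasFDerivAt_const (1 : ℝ) x).congr_of_eventuallyEq (h.mono fun y hy => by simp [hy])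
  have h3 := h1.unique h2
  let e := r'.toContinuousLinearEquivOfDetNeZero hdet
  have h4 := congrArg (fun L : H →L[ℝ] ℝ => L (e.symm (r x))) h3
  have h5 : r' (e.symm (r x)) = r x := e.apply_symm_apply (r x)
  simp [h5, h.self_of_nhds] at h4

theorem image_ball_eq_ball_of_map_nhds {f : H → H} (hc : ContinuousOn f (closedBall 0 1))
    (hmap : ∀ x ∈ closedBall (0 : H) 1, f x ∈ closedBall (0 : H) 1)
    (hsph : ∀ x ∈ sphere (0 : H) 1, f x = x)
    (hopen : ∀ x ∈ ball (0 : H) 1, Filter.map f (nhds x) = nhds (f x)) :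
    f '' ball 0 1 = ball 0 1 := by
  have ho : IsOpen (f '' ball (0 : H) 1) := by
    rw [isOpen_iff_mem_nhds]
    rintro _ ⟨x, hx, rfl⟩
    rw [← hopen x hx]
    exact Filter.image_mem_map (isOpen_ball.mem_nhds hx)
  have hsub : f '' ball (0 : H) 1 ⊆ ball 0 1 := by
    rcases subsingleton_or_nontrivial H with hH | hH
    · rintro y -
      rw [Subsingleton.elim y 0]
      simp
    · rw [← interior_closedBall (0 : H) one_ne_zero]
      refine interior_maximal ?_ (by rwa [interior_closedBall _ one_ne_zero])
      rintro _ ⟨x, hx, rfl⟩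
      exact hmap x (interior_subset hx)
  refine hsub.antisymm ?_
  refine (convex_ball (0 : H) 1).isPreconnected.subset_of_closure_inter_subset ho ?_ ?_
  · exact ⟨f 0, hsub ⟨0, by simp, rfl⟩, 0, by simp, rfl⟩
  · rintro y ⟨hy, hy1⟩
    have hcl : IsClosed (f '' closedBall (0 : H) 1) :=
      ((isCompact_closedBall 0 1).image_of_continuousOn hc).isClosed
    obtain ⟨x, hx, rfl⟩ := closure_minimal (image_mono ball_subset_closedBall) hcl hy
    refine ⟨x, ?_, rfl⟩
    by_contra hxb
    have hxs : x ∈ sphere (0 : H) 1 := by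
      simp only [mem_closedBall, mem_ball, mem_sphere, not_lt] at *
      exact le_antisymm hx hxb
    rw [hsph x hxs] at hy1
    exact hxb hy1

/-- There is no `C¹` retraction of the closed unit ball onto its boundary sphere. -/
theorem not_exists_contDiffOn_retraction {U : Set H} (hU : IsOpen U)
    (hBU : closedBall (0 : H) 1 ⊆ U) {r : H → H} (hr : ContDiffOn ℝ 1 r U)
    (hnorm : ∀ x ∈ closedBall (0 : H) 1, ‖r x‖ = 1) (hsph : ∀ x ∈ sphere (0 : H) 1, r x = x) :
    False := by
  borelize H
  let p : H → H := fun x => r x - x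
  let p' : H → H →L[ℝ] H := fun x => fderiv ℝ r x - ContinuousLinearMap.id ℝ H
  have hstrict : ∀ x ∈ U, HasStrictFDerivAt r (fderiv ℝ r x) x := fun x hx =>
    (hr.contDiffAt (hU.mem_nhds hx)).hasStrictFDerivAt one_ne_zero
  have hp : ∀ x ∈ U, HasStrictFDerivAt p (p' x) x := fun x hx =>
    (hstrict x hx).sub (hasStrictFDerivAt_id x)
  have hp'c : ContinuousOn p' (closedBall 0 1) :=
    ((hr.continuousOn_fderiv_of_isOpen hU le_rfl).mono hBU).sub continuousOn_const
  obtain ⟨K, hK⟩ := (isCompact_closedBall (0 : H) 1).exists_bound_of_continuousOn hp'c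
  have hK0 : 0 ≤ K := (norm_nonneg _).trans (hK 0 (by simp))
  have hlip : ∀ x ∈ closedBall (0 : H) 1, ∀ y ∈ closedBall (0 : H) 1,
      ‖p y - p x‖ ≤ K * ‖y - x‖ := fun x hx y hy =>
    (convex_closedBall (0 : H) 1).norm_image_sub_le_of_norm_hasFDerivWithin_le
      (fun z hz => (hp z (hBU hz)).hasFDerivAt.hasFDerivWithinAt) hK hx hy
  have hint : ∀ t : ℝ, IntegrableOn
      (fun x => (ContinuousLinearMap.id ℝ H + t • p' x).det) (ball 0 1) := fun t =>
    ((ContinuousLinearMap.continuous_det.comp_continuousOn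
      (continuousOn_const.add (hp'c.const_smul t))).integrableOn_compact
        (isCompact_closedBall _ _)).mono_set ball_subset_closedBall
  -- for small `t` the map `x + t p x` permutes the ball, so its Jacobian integrates to the volume
  have hvol : ∀ t : ℝ, 0 ≤ t → t < (K + 1)⁻¹ →
      ∫ x in ball (0 : H) 1, (ContinuousLinearMap.id ℝ H + t • p' x).det =
        volume.real (ball (0 : H) 1) := by
    intro t ht0 ht
    have htK : t * (K + 1) < 1 := (lt_inv_mul_iff₀' (by positivity)).1 (by simpa using ht)
    have htK' : t * K < 1 := by nlinarith
    have ht1 : t ≤ 1 := by nlinarith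
    let f : H → H := fun x => x + t • p x
    have hf : ∀ x ∈ U, HasStrictFDerivAt f (ContinuousLinearMap.id ℝ H + t • p' x) x :=
      fun x hx => (hasStrictFDerivAt_id x).add ((hp x hx).const_smul t)
    have hsmall : ∀ x ∈ closedBall (0 : H) 1, ‖t • p' x‖ < 1 := by
      intro x hx
      rw [norm_smul, Real.norm_of_nonneg ht0]
      exact lt_of_le_of_lt (mul_le_mul_of_nonneg_left (hK x hx) ht0) htK'
    have hinj : InjOn f (ball 0 1) := by
      intro x hx y hy hxy
      have h1 : y - x = -(t • (p y - p x)) := by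
        rw [smul_sub, neg_sub, sub_eq_sub_iff_add_eq_add, add_comm (t • p x)]
        exact hxy.symm
      have h2 : ‖y - x‖ ≤ t * (K * ‖y - x‖) := by
        conv_lhs => rw [h1, norm_neg, norm_smul, Real.norm_of_nonneg ht0]
        exact mul_le_mul_of_nonneg_left
          (hlip x (ball_subset_closedBall hx) y (ball_subset_closedBall hy)) ht0
      have h3 : ‖y - x‖ = 0 := by nlinarith [norm_nonneg (y - x)]
      exact (sub_eq_zero.1 (norm_eq_zero.1 h3)).symm
    have himg : f '' ball 0 1 = ball 0 1 := by
      apply image_ball_eq_ball_of_map_nhds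
      · exact fun x hx => (hf x (hBU hx)).continuousAt.continuousWithinAt
      · intro x hx
        have h1 : f x = (1 - t) • x + t • r x := by
          simp only [f, p]
          module
        rw [h1]
        exact convex_closedBall (0 : H) 1 hx (by simp [hnorm x hx]) (by linarith) ht0 (by ring)
      · intro x hx
        simp [f, p, hsph x hx]
      · intro x hx
        refine (hf x (hBU (ball_subset_closedBall hx))).map_nhds_eq_of_surj ?_
        exact LinearMap.range_eq_top.2
          (ContinuousLinearMap.bijective_id_add_of_norm_lt_one
            (hsmall x (ball_subset_closedBall hx))).2
    have h1 := integral_image_eq_integral_abs_det_fderiv_smul volume measurableSet_ball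
      (fun x hx => (hf x (hBU (ball_subset_closedBall hx))).hasFDerivAt.hasFDerivWithinAt)
      hinj (fun _ => (1 : ℝ))
    rw [himg] at h1
    simp only [smul_eq_mul, mul_one, integral_const, MeasurableSet.univ,
      measureReal_restrict_apply, univ_inter] at h1
    rw [h1]
    refine setIntegral_congr_fun measurableSet_ball fun x hx => ?_
    exact (abs_of_pos (ContinuousLinearMap.det_id_add_pos
      (hsmall x (ball_subset_closedBall hx)))).symm
  let t : ℕ → ℝ := fun i => (K + 1)⁻¹ * ((i : ℝ) + 2)⁻¹
  have hKpos : 0 < (K + 1)⁻¹ := by positivity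
  have ht : Function.Injective t := by
    intro i j hij
    have := inv_injective (mul_left_cancel₀ hKpos.ne' hij)
    exact_mod_cast add_right_cancel this
  have hzero : ∫ x in ball (0 : H) 1, (ContinuousLinearMap.id ℝ H + p' x).det = 0 := by
    rw [setIntegral_congr_fun (g := fun _ => (0 : ℝ)) measurableSet_ball, integral_zero]
    intro x hx
    have h1 : ContinuousLinearMap.id ℝ H + p' x = fderiv ℝ r x := by simp [p']
    simp only [h1]
    refine det_eq_zero_of_norm_eventually_eq_one
      (hstrict x (hBU (ball_subset_closedBall hx))).hasFDerivAt ?_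
    filter_upwards [isOpen_ball.mem_nhds hx] with y hy using hnorm y (ball_subset_closedBall hy)
  rw [setIntegral_congr_fun measurableSet_ball fun x _ =>
    det_id_add_eq_sum_lagrange t ht (p' x)] at hzero
  rw [integral_finsetSum _ fun i _ => (hint (t i)).const_mul _] at hzero
  have hone : ∑ i ∈ Finset.range (Module.finrank ℝ H + 1),
      (Lagrange.basis (Finset.range (Module.finrank ℝ H + 1)) t i).eval 1 = 1 := by
    rw [← Polynomial.eval_finsetSum, Lagrange.sum_basis ht.injOn (by simp), Polynomial.eval_one]
  have hti : ∀ i, t i < (K + 1)⁻¹ := fun i =>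
    mul_lt_of_lt_one_right hKpos (inv_lt_one_of_one_lt₀ (by linarith [Nat.cast_nonneg (α := ℝ) i]))
  have hti0 : ∀ i, 0 ≤ t i := fun i => by positivity
  simp_rw [integral_const_mul, hvol _ (hti0 _) (hti _)] at hzero
  rw [← Finset.sum_mul, hone, one_mul] at hzero
  exact (ENNReal.toReal_pos (measure_ball_pos volume (0 : H) one_pos).ne'
    measure_ball_lt_top.ne).ne' hzero

theorem exists_fixedPoint_of_contDiff {g : H → H} (hg : ContDiff ℝ 1 g) (hb : ∀ x, ‖g x‖ ≤ 1) :
    ∃ x, g x = x := by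
  by_contra! hne
  let w : H → H := fun x => x - g x
  have hw : ∀ x, w x ≠ 0 := fun x h => hne x (sub_eq_zero.1 h).symm
  have hwc : ContDiff ℝ 1 w := contDiff_id.sub hg
  let D : H → ℝ := fun x => inner ℝ x (w x) ^ 2 + ‖w x‖ ^ 2 * (1 - ‖x‖ ^ 2)
  have hD : ContDiff ℝ 1 D :=
    ((contDiff_id.inner ℝ hwc).pow 2).add
      ((hwc.norm_sq ℝ).mul (contDiff_const.sub (contDiff_id.norm_sq ℝ)))
  let s : H → ℝ := fun x => (-inner ℝ x (w x) + √(D x)) / ‖w x‖ ^ 2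
  have hinner : ∀ x ∈ sphere (0 : H) 1, 0 < inner ℝ x (w x) := by
    intro x hx
    have hx1 : ‖x‖ = 1 := by simpa using hx
    have h1 : inner ℝ x (w x) = 1 - inner ℝ x (g x) := by
      simp [w, inner_sub_right, hx1]
    have h2 : inner ℝ x (g x) ≤ 1 := by
      have := real_inner_le_norm x (g x)
      rw [hx1, one_mul] at this
      exact this.trans (hb x)
    have h4 : 0 < ‖w x‖ ^ 2 := by have := norm_pos_iff.2 (hw x); positivity
    have h3 : ‖w x‖ ^ 2 = 1 - 2 * inner ℝ x (g x) + ‖g x‖ ^ 2 := by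
      simp only [w]
      rw [norm_sub_sq_real, hx1, one_pow]
    nlinarith [hb x, norm_nonneg (g x)]
  have hDpos : ∀ x ∈ closedBall (0 : H) 1, 0 < D x := by
    intro x hx
    have hx1 : ‖x‖ ≤ 1 := by simpa using hx
    rcases hx1.lt_or_eq with h | h
    · have h4 : 0 < ‖w x‖ ^ 2 := by have := norm_pos_iff.2 (hw x); positivity
      have h5 : 0 < 1 - ‖x‖ ^ 2 := by nlinarith [norm_nonneg x]
      have := mul_pos h4 h5
      simp only [D]
      positivity
    · have := hinner x (by simpa using h)
      simp only [D, h]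
      nlinarith
  refine not_exists_contDiffOn_retraction (U := {x | 0 < D x}) (r := fun x => x + s x • w x)
    (isOpen_lt continuous_const hD.continuous) hDpos ?_ ?_ ?_
  · refine contDiffOn_id.add (ContDiffOn.smul ?_ hwc.contDiffOn)
    refine ContDiffOn.div ?_ (hwc.norm_sq ℝ).contDiffOn
      fun x _ => pow_ne_zero 2 (norm_ne_zero_iff.2 (hw x))
    exact (contDiff_id.inner ℝ hwc).neg.contDiffOn.add
      (hD.contDiffOn.sqrt fun x hx => (ne_of_gt hx))
  · intro x hx
    have h4 : ‖w x‖ ^ 2 ≠ 0 := pow_ne_zero 2 (norm_ne_zero_iff.2 (hw x))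
    have h5 : s x * ‖w x‖ ^ 2 = -inner ℝ x (w x) + √(D x) := div_mul_cancel₀ _ h4
    have h6 := Real.sq_sqrt (hDpos x hx).le
    have h7 : ‖x + s x • w x‖ ^ 2 = ‖x‖ ^ 2 + 2 * (s x * inner ℝ x (w x)) +
        s x ^ 2 * ‖w x‖ ^ 2 := by
      rw [norm_add_sq_real, inner_smul_right, norm_smul, mul_pow, Real.norm_eq_abs, sq_abs]
    have h8 : ‖w x‖ ^ 2 * (‖x + s x • w x‖ ^ 2 - 1) = 0 := by
      have h9 : √(D x) = s x * ‖w x‖ ^ 2 + inner ℝ x (w x) := by linarith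
      rw [h9] at h6
      simp only [D] at h6
      rw [h7]
      linarith
    have h10 : ‖x + s x • w x‖ ^ 2 = 1 := by
      rcases mul_eq_zero.1 h8 with h | h
      · exact absurd h h4
      · linarith
    exact (pow_eq_one_iff_of_nonneg (norm_nonneg _) two_ne_zero).1 h10
  · intro x hx
    have hx1 : ‖x‖ = 1 := by simpa using hx
    have : s x = 0 := by
      simp [s, D, hx1, Real.sqrt_sq (hinner x hx).le]
    simp [this]

theorem exists_fixedPoint_of_continuous_inner {f : H → H} (hf : Continuous f)
    (hb : ∀ x, ‖f x‖ ≤ 1) : ∃ x, f x = x := by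
  by_contra! hne
  have hcont : ContinuousOn (fun x => ‖f x - x‖) (closedBall 0 1) := by fun_prop
  obtain ⟨x₀, -, hmin⟩ := (isCompact_closedBall (0 : H) 1).exists_isMinOn ⟨0, by simp⟩ hcont
  set ε := ‖f x₀ - x₀‖ / 2 with hε
  have hεpos : 0 < ε := half_pos (norm_pos_iff.2 (sub_ne_zero.2 (hne x₀)))
  obtain ⟨g, hg, happ, -⟩ := hf.exists_contDiff_approx 1 (ε := fun _ => ε) continuous_const
    fun _ => hεpos
  have hgb : ∀ x, ‖g x‖ ≤ 1 + ε := fun x => by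
    have h1 := happ x
    rw [dist_eq_norm] at h1
    have h2 := norm_sub_norm_le (g x) (f x)
    linarith [hb x]
  obtain ⟨x, hx⟩ := exists_fixedPoint_of_contDiff (g := fun x => (1 + ε)⁻¹ • g x)
    (contDiff_const.smul hg) fun x => by
      rw [norm_smul, Real.norm_of_nonneg (by positivity)]
      exact inv_mul_le_one_of_le₀ (hgb x) (by positivity)
  have hx' : g x = (1 + ε) • x := by
    conv_rhs => rw [← hx, smul_inv_smul₀ (by positivity)]
  have hx1 : ‖x‖ ≤ 1 := by
    have h := hgb x
    rw [hx', norm_smul, Real.norm_of_nonneg (by positivity)] at h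
    exact le_of_mul_le_mul_left (by linarith) (show 0 < 1 + ε by positivity)
  have h1 : ‖f x - x‖ ≤ ‖g x - f x‖ + ‖g x - x‖ := by
    rw [← norm_sub_rev (f x)]
    exact norm_sub_le_norm_sub_add_norm_sub _ _ _
  have h2 : ‖g x - x‖ ≤ ε := by
    rw [hx', add_smul, one_smul, add_sub_cancel_left, norm_smul, Real.norm_of_nonneg hεpos.le]
    exact mul_le_of_le_one_right hεpos.le hx1
  have h3 : ‖f x₀ - x₀‖ ≤ ‖f x - x‖ := hmin (by simpa using hx1)
  have h4 := happ x
  rw [dist_eq_norm] at h4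
  linarith

/-- The Brouwer fixed point theorem for a closed ball of a finite-dimensional normed space. -/
theorem exists_fixedPoint_mem_closedBall {V : Type*} [NormedAddCommGroup V] [NormedSpace ℝ V]
    [FiniteDimensional ℝ V] {f : V → V} (hf : Continuous f) {R : ℝ}
    (hb : ∀ x, ‖x‖ ≤ R → ‖f x‖ ≤ R) (hR : 0 < R) : ∃ x, ‖x‖ ≤ R ∧ f x = x := by
  let ρ : V → V := fun x => (R / max R ‖x‖) • x
  have hmax : ∀ x : V, 0 < max R ‖x‖ := fun x => lt_max_of_lt_left hR
  have hρ : Continuous ρ :=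
    (continuous_const.div (by fun_prop) fun x => (hmax x).ne').smul continuous_id
  have hρR : ∀ x, ‖ρ x‖ ≤ R := fun x => by
    rw [norm_smul, Real.norm_of_nonneg (div_nonneg hR.le (hmax x).le), div_mul_eq_mul_div,
      div_le_iff₀ (hmax x)]
    exact mul_le_mul_of_nonneg_left (le_max_right _ _) hR.le
  let e : V ≃L[ℝ] EuclideanSpace ℝ (Fin (Module.finrank ℝ V)) :=
    ContinuousLinearEquiv.ofFinrankEq (by simp)
  let c : ℝ := ‖(e : V →L[ℝ] EuclideanSpace ℝ (Fin (Module.finrank ℝ V)))‖ * R + 1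
  have hc : 0 < c := by positivity
  obtain ⟨y, hy⟩ := exists_fixedPoint_of_continuous_inner
    (f := fun y => c⁻¹ • e (f (ρ (e.symm (c • y))))) (by fun_prop) fun y => by
      rw [norm_smul, Real.norm_of_nonneg (by positivity)]
      refine inv_mul_le_one_of_le₀ ?_ hc.le
      refine ((e : V →L[ℝ] EuclideanSpace ℝ (Fin (Module.finrank ℝ V))).le_opNorm _).trans ?_
      have := mul_le_mul_of_nonneg_left (hb _ (hρR (e.symm (c • y))))
        (norm_nonneg (e : V →L[ℝ] EuclideanSpace ℝ (Fin (Module.finrank ℝ V))))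
      simp only [c]
      linarith
  have hx : f (ρ (e.symm (c • y))) = e.symm (c • y) := by
    conv_rhs => rw [← hy, smul_inv_smul₀ hc.ne', e.symm_apply_apply]
  have hxR : ‖e.symm (c • y)‖ ≤ R := hx ▸ hb _ (hρR _)
  have hρx : ρ (e.symm (c • y)) = e.symm (c • y) := by
    simp only [ρ]
    rw [max_eq_left hxR, div_self hR.ne', one_smul]
  exact ⟨_, hxR, by rwa [hρx] at hx⟩

end Brouwer

section BiShadowing

variable {E F : Type*} [NormedAddCommGroup E] [NormedSpace ℝ E]
  [NormedAddCommGroup F] [NormedSpace ℝ F]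

/-- A periodic family of maps admits a periodic orbit in the closed ball as soon as each of them is
close, on that ball, to a linear map expanding `E` and contracting `F`. -/
theorem exists_periodic_orbit_of_near_hyperbolic [FiniteDimensional ℝ E] [FiniteDimensional ℝ F]
    {lam μ ε η : ℝ} (h0 : 0 < lam) (hη : 0 < η)
    {L : ℤ → (E × F) →L[ℝ] E × F} {G : ℤ → E × F → E × F}
    (hA : ∀ j v, lam⁻¹ * ‖v‖ ≤ ‖(L j (v, 0)).1‖)
    (hB : ∀ j s, ‖(L j (0, s)).1‖ ≤ μ * ‖s‖)
    (hC : ∀ j v, ‖(L j (v, 0)).2‖ ≤ μ * ‖v‖)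
    (hD : ∀ j s, ‖(L j (0, s)).2‖ ≤ lam * ‖s‖) (hμ : 0 ≤ μ)
    (hG : ∀ j, Continuous (G j))
    (hGL : ∀ j ξ, ‖ξ‖ ≤ η → ‖G j ξ - L j ξ‖ ≤ ε)
    (hu : lam * (η + μ * η + ε) ≤ η) (hs : μ * η + lam * η + ε ≤ η)
    {N : ℕ} (hN : 0 < N) (hper : ∀ j : ℤ, G (j + N) = G j) :
    ∃ v : ℤ → E × F, (∀ j, ‖v j‖ ≤ η) ∧ (∀ j, v (j + 1) = G j (v j)) ∧
      ∀ j : ℤ, v (j + N) = v j := by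
  have : NeZero N := ⟨hN.ne'⟩
  have hsplit : ∀ j (ξ : E × F), L j ξ = L j (ξ.1, 0) + L j (0, ξ.2) := fun j ξ => by
    rw [← map_add]
    simp
  let A : ℤ → E →ₗ[ℝ] E := fun j =>
    (LinearMap.fst ℝ E F).comp ((L j : (E × F) →ₗ[ℝ] E × F).comp (LinearMap.inl ℝ E F))
  have hAL : ∀ j v, A j v = (L j (v, 0)).1 := fun _ _ => rfl
  have hAinj : ∀ j, Function.Injective (A j) := fun j => by
    rw [← LinearMap.ker_eq_bot, LinearMap.ker_eq_bot']
    intro v hv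
    have h := hA j v
    rw [← hAL, hv, norm_zero] at h
    exact norm_le_zero_iff.1 (nonpos_of_mul_nonpos_right h (inv_pos.2 h0))
  let e : ℤ → E ≃L[ℝ] E := fun j =>
    (LinearEquiv.ofInjectiveEndo (A j) (hAinj j)).toContinuousLinearEquiv
  have he : ∀ j v, e j v = (L j (v, 0)).1 := fun _ _ => rfl
  have hesymm : ∀ j y, ‖(e j).symm y‖ ≤ lam * ‖y‖ := fun j y => by
    have h := hA j ((e j).symm y)
    rwa [← he, (e j).apply_symm_apply, inv_mul_le_iff₀ h0] at h
  let T : (ZMod N → E × F) → ZMod N → E × F := fun v k =>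
    ((e k.val).symm ((v (k + 1)).1 - (G k.val (v k)).1 + e k.val (v k).1),
      (G (k - 1).val (v (k - 1))).2)
  have hTc : Continuous T := by fun_prop
  obtain ⟨w, hwη, hw⟩ := exists_fixedPoint_mem_closedBall hTc (R := η) (fun v hv => by
    have hvk : ∀ k, ‖v k‖ ≤ η := (pi_norm_le_iff_of_nonneg hη.le).1 hv
    have hv1 : ∀ k, ‖(v k).1‖ ≤ η := fun k => (norm_fst_le _).trans (hvk k)
    have hv2 : ∀ k, ‖(v k).2‖ ≤ η := fun k => (norm_snd_le _).trans (hvk k)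
    refine (pi_norm_le_iff_of_nonneg hη.le).2 fun k => max_le ?_ ?_
    · refine (hesymm _ _).trans (le_trans (mul_le_mul_of_nonneg_left ?_ h0.le) hu)
      have h1 : (v (k + 1)).1 - (G k.val (v k)).1 + e k.val (v k).1 =
          (v (k + 1)).1 - (L k.val (0, (v k).2)).1 - (G k.val (v k) - L k.val (v k)).1 := by
        rw [he, hsplit _ (v k), Prod.fst_sub, Prod.fst_add]
        abel
      rw [h1]
      refine (norm_sub_le _ _).trans (add_le_add ((norm_sub_le _ _).trans (add_le_add (hv1 _) ?_))
        ((norm_fst_le _).trans (hGL _ _ (hvk k))))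
      exact (hB _ _).trans (mul_le_mul_of_nonneg_left (hv2 k) hμ)
    · have h1 : (G (k - 1).val (v (k - 1))).2 =
          (L (k - 1).val ((v (k - 1)).1, 0)).2 + (L (k - 1).val (0, (v (k - 1)).2)).2 +
            (G (k - 1).val (v (k - 1)) - L (k - 1).val (v (k - 1))).2 := by
        rw [Prod.snd_sub, hsplit _ (v (k - 1)), Prod.snd_add]
        abel
      rw [h1]
      refine le_trans ((norm_add_le _ _).trans (add_le_add ((norm_add_le _ _).trans
        (add_le_add ?_ ?_)) ((norm_snd_le _).trans (hGL _ _ (hvk _))))) hs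
      · exact (hC _ _).trans (mul_le_mul_of_nonneg_left (hv1 _) hμ)
      · exact (hD _ _).trans (mul_le_mul_of_nonneg_left (hv2 _) h0.le)) hη
  have hval : ∀ j : ℤ, G ((j : ZMod N).val : ℤ) = G j := fun j => by
    rw [ZMod.val_intCast]
    conv_rhs => rw [← Int.emod_add_mul_ediv j N, mul_comm]
    exact (Function.Periodic.int_mul hper _ _).symm
  refine ⟨fun j => w j, fun j => (pi_norm_le_iff_of_nonneg hη.le).1 hwη _, fun j => ?_,
    fun j => by simp⟩
  ext1
  · have h := congrArg (fun x => e ((j : ZMod N).val : ℤ) x.1) (congrFun hw (j : ZMod N))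
    simp only [T, ContinuousLinearEquiv.apply_symm_apply, hval] at h
    push_cast
    rw [add_eq_right, sub_eq_zero] at h
    exact h
  · have h := congrArg Prod.snd (congrFun hw ((j : ZMod N) + 1))
    simp only [T, add_sub_cancel_right, hval] at h
    push_cast
    exact h.symm

end BiShadowing

/-- Theorem 4.2 (local chart form of periodic bi-shadowing): if in addition the
data (F_j, G_j) are N-periodic in j, the full two-sided orbit of the maps G_j
staying in the closed η-ball can be chosen N-periodic. -/
theorem periodic_bi_shadowing_local
    {E F : Type*} [NormedAddCommGroup E] [NormedSpace ℝ E]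
    [NormedAddCommGroup F] [NormedSpace ℝ F]
    [FiniteDimensional ℝ E] [FiniteDimensional ℝ F]
    (lam lamt η d δ : ℝ) (h0 : 0 < lam) (h1 : lam < lamt)
    (h2 : lamt < (1 + lam) / 2) (hη : 0 < η) (hd : 0 ≤ d) (hδ : 0 ≤ δ)
    (Fmap : ℤ → E × F → E × F) (DF : ℤ → E × F → (E × F) →L[ℝ] E × F)
    (G : ℤ → E × F → E × F)
    (hderiv : ∀ j : ℤ, ∀ ξ ∈ Metric.closedBall (0 : E × F) η,
      HasFDerivAt (Fmap j) (DF j ξ) ξ)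
    (hcont : ∀ j : ℤ, ContinuousOn (DF j) (Metric.closedBall (0 : E × F) η))
    (hA : ∀ j : ℤ, ∀ v : E, lam⁻¹ * ‖v‖ ≤ ‖(DF j 0 (v, 0)).1‖)
    (hD : ∀ j : ℤ, ‖(ContinuousLinearMap.snd ℝ E F).comp
        ((DF j 0).comp (ContinuousLinearMap.inr ℝ E F))‖ ≤ lam)
    (hB : ∀ j : ℤ, ‖(ContinuousLinearMap.fst ℝ E F).comp
        ((DF j 0).comp (ContinuousLinearMap.inr ℝ E F))‖ ≤ (1 + lam - 2 * lamt) / 4)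
    (hC : ∀ j : ℤ, ‖(ContinuousLinearMap.snd ℝ E F).comp
        ((DF j 0).comp (ContinuousLinearMap.inl ℝ E F))‖ ≤ (1 + lam - 2 * lamt) / 4)
    (hclose : ∀ j : ℤ, ∀ ξ : E × F, ‖ξ‖ ≤ η → ‖DF j ξ - DF j 0‖ ≤ (lamt - lam) / 4)
    (hGcont : ∀ j : ℤ, Continuous (G j))
    (hF0 : ∀ j : ℤ, ‖Fmap j 0‖ ≤ δ)
    (hGF : ∀ j : ℤ, ∀ ξ : E × F, ‖ξ‖ ≤ η → ‖G j ξ - Fmap j ξ‖ ≤ d)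
    (hsum : d + δ ≤ (1 - lamt) * η / 2)
    (N : ℕ) (hN : 0 < N)
    (hFper : ∀ j : ℤ, Fmap (j + N) = Fmap j)
    (hGper : ∀ j : ℤ, G (j + N) = G j) :
    ∃ v : ℤ → E × F, (∀ j : ℤ, ‖v j‖ ≤ η) ∧
      (∀ j : ℤ, v (j + 1) = G j (v j)) ∧
      ∀ j : ℤ, v (j + N) = v j := by
  have hrem : ∀ j ξ, ‖ξ‖ ≤ η → ‖Fmap j ξ - Fmap j 0 - DF j 0 ξ‖ ≤ (lamt - lam) / 4 * η := by
    intro j ξ hξ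
    have h := (convex_closedBall (0 : E × F) η).norm_image_sub_le_of_norm_hasFDerivWithin_le'
      (φ := DF j 0) (fun x hx => (hderiv j x hx).hasFDerivWithinAt)
      (fun x hx => hclose j x (by simpa using hx)) (mem_closedBall_self hη.le)
      (show ξ ∈ closedBall 0 η by simpa using hξ)
    rw [sub_zero] at h
    exact h.trans (mul_le_mul_of_nonneg_left hξ (by linarith))
  refine exists_periodic_orbit_of_near_hyperbolic (L := fun j => DF j 0) (lam := lam)
    (μ := (1 + lam - 2 * lamt) / 4) (ε := d + (lamt - lam) / 4 * η + δ) h0 hη hA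
    (fun j s => ContinuousLinearMap.le_of_opNorm_le _ (hB j) s)
    (fun j v => ContinuousLinearMap.le_of_opNorm_le _ (hC j) v)
    (fun j s => ContinuousLinearMap.le_of_opNorm_le _ (hD j) s) (by linarith) hGcont
    ?_ ?_ ?_ hN hGper
  · intro j ξ hξ
    have h : G j ξ - DF j 0 ξ =
        (G j ξ - Fmap j ξ) + (Fmap j ξ - Fmap j 0 - DF j 0 ξ) + Fmap j 0 := by abel
    rw [h]
    exact (norm_add_le _ _).trans (add_le_add ((norm_add_le _ _).trans
      (add_le_add (hGF j ξ hξ) (hrem j ξ hξ))) (hF0 j))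
  · have h3 : η + (1 + lam - 2 * lamt) / 4 * η + (d + (lamt - lam) / 4 * η + δ) ≤
        (7 - 3 * lamt) / 4 * η := by linarith
    have h4 : lam * (7 - 3 * lamt) ≤ 4 := by nlinarith
    calc _ ≤ lam * ((7 - 3 * lamt) / 4 * η) := mul_le_mul_of_nonneg_left h3 h0.le
      _ = lam * (7 - 3 * lamt) / 4 * η := by ring
      _ ≤ η := mul_le_of_le_one_left hη.le (by linarith)
  · nlinarith
end
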